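/- Suppose A_j^{(1)} and A_j^{(2)}, 0≤j≤2, are C^∞ m×m complex matrix-valued functions on ℝ² with support in B_R = {x∈ℝ²:|x|<R}, and suppose they have the same non-abelian Radon transform, i.e. S(A^{(1)})(x⊥,θ) = S(A^{(2)})(x⊥,θ) for every unit vector θ∈S¹ and every x⊥ perpendicular to θ. Then A^{(1)} and A^{(2)} are gauge equivalent: there exists a C^∞ m×m matrix-valued function g on ℝ² with det g(x)≠0 for all x and g(x)=I_m for |x|≥R such that A_j^{(2)} = g A_j^{(1)} g^{-1} + (∂g/∂x_j) g^{-1} for j=1,2 and A_0^{(2)} = g A_0^{(1)} g^{-1}. -/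

import Mathlib

noncomputable section

open MeasureTheory Filter Topology Complex Matrix

abbrev R2 : Type := EuclideanSpace ℝ (Fin 2)
abbrev Mat (m : ℕ) : Type := Matrix (Fin m) (Fin m) ℂ
abbrev Vec (m : ℕ) : Type := Fin m → ℂ

/-- the point (a,b) ∈ ℝ² -/
def mk2 (a b : ℝ) : R2 := (WithLp.equiv 2 (Fin 2 → ℝ)).symm ![a, b]
def e1 : R2 := mk2 1 0
def e2 : R2 := mk2 0 1

/-- partial derivative of a scalar function in direction v -/
def pdv (v : R2) (f : R2 → ℂ) (x : R2) : ℂ := fderiv ℝ f x v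

def zeta1 (t : ℂ) : ℂ := (t + t⁻¹) / 2
def zeta2 (t : ℂ) : ℂ := (t - t⁻¹) / (2 * Complex.I)

/-- z = x₁ + i x₂ -/
def zOf (x : R2) : ℂ := (x 0 : ℂ) + Complex.I * (x 1 : ℂ)

/-- the kernel denominator t(z−z′)+t⁻¹(z̄−z̄′) -/
def ker (t : ℂ) (x y : R2) : ℂ :=
  t * (zOf x - zOf y) + t⁻¹ * (starRingEnd ℂ) (zOf x - zOf y)

/-- ζ·∂c/∂x for a matrix-valued function, entrywise -/
def zDirM {m : ℕ} (z1 z2 : ℂ) (c : R2 → Mat m) (x : R2) : Mat m :=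
  Matrix.of fun i j => z1 * pdv e1 (fun y => c y i j) x + z2 * pdv e2 (fun y => c y i j) x

def zDirV {m : ℕ} (z1 z2 : ℂ) (u : R2 → Vec m) (x : R2) : Vec m :=
  fun i => z1 * pdv e1 (fun y => u y i) x + z2 * pdv e2 (fun y => u y i) x

/-- ∂/∂z̄ of a matrix-valued function -/
def dzbarM {m : ℕ} (c : R2 → Mat m) (x : R2) : Mat m :=
  Matrix.of fun i j =>
    (pdv e1 (fun y => c y i j) x + Complex.I * pdv e2 (fun y => c y i j) x) / 2

def dzbarV {m : ℕ} (u : R2 → Vec m) (x : R2) : Vec m :=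
  fun i => (pdv e1 (fun y => u y i) x + Complex.I * pdv e2 (fun y => u y i) x) / 2

def dzM {m : ℕ} (c : R2 → Mat m) (x : R2) : Mat m :=
  Matrix.of fun i j =>
    (pdv e1 (fun y => c y i j) x - Complex.I * pdv e2 (fun y => c y i j) x) / 2

/-- the operator Π(t), matrix-valued version -/
def PiTM {m : ℕ} (t : ℂ) (f : R2 → Mat m) (x : R2) : Mat m :=
  Matrix.of fun i j => (Real.pi : ℂ)⁻¹ * ∫ y : R2, f y i j / ker t x y

def PiTV {m : ℕ} (t : ℂ) (f : R2 → Vec m) (x : R2) : Vec m :=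
  fun i => (Real.pi : ℂ)⁻¹ * ∫ y : R2, f y i / ker t x y

/-- the Cauchy transform S -/
def CauchyM {m : ℕ} (f : R2 → Mat m) (x : R2) : Mat m :=
  Matrix.of fun i j => (Real.pi : ℂ)⁻¹ * ∫ y : R2, f y i j / (zOf x - zOf y)

def CauchyV {m : ℕ} (f : R2 → Vec m) (x : R2) : Vec m :=
  fun i => (Real.pi : ℂ)⁻¹ * ∫ y : R2, f y i / (zOf x - zOf y)

/-- the contour integral ∮_{|t|=ρ} F(t) dt -/
def circIntM {m : ℕ} (F : ℂ → Mat m) (ρ : ℝ) : Mat m :=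
  Matrix.of fun i j => ∫ φ in (0:ℝ)..(2*Real.pi),
    F ((ρ:ℂ) * Complex.exp (Complex.I * φ)) i j * (Complex.I * ρ * Complex.exp (Complex.I * φ))

def circIntV {m : ℕ} (F : ℂ → Vec m) (ρ : ℝ) : Vec m :=
  fun i => ∫ φ in (0:ℝ)..(2*Real.pi),
    F ((ρ:ℂ) * Complex.exp (Complex.I * φ)) i * (Complex.I * ρ * Complex.exp (Complex.I * φ))

def MatSmooth {m : ℕ} (c : R2 → Mat m) : Prop := ∀ i j, ContDiff ℝ (⊤ : ℕ∞) (fun x => c x i j)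

def SuppIn {m : ℕ} (A : R2 → Mat m) (R : ℝ) : Prop := ∀ x : R2, R ≤ ‖x‖ → A x = 0

/-- A(x,ζ) = ζ₁A₁(x)+ζ₂A₂(x)+A₀(x) -/
def Acomb {m : ℕ} (A0 A1 A2 : R2 → Mat m) (z1 z2 : ℂ) (x : R2) : Mat m :=
  z1 • A1 x + z2 • A2 x + A0 x

/-- c solves θ·∂c/∂x = M(x)c along every line in direction θ -/
def Transport {m : ℕ} (M : R2 → Mat m) (θ : R2) (c : R2 → Mat m) : Prop :=
  ∀ x : R2, ∀ i j, HasDerivAt (fun s : ℝ => c (x + s • θ) i j) ((M x * c x) i j) 0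

/-! ### Directional derivatives -/

lemma contDiff_pdv {f : R2 → ℂ} (hf : ContDiff ℝ (⊤ : ℕ∞) f) (v : R2) :
    ContDiff ℝ (⊤ : ℕ∞) (pdv v f) := by
  have h : ContDiff ℝ (⊤ : ℕ∞) (fderiv ℝ f) := hf.fderiv_right (by simp)
  exact h.clm_apply contDiff_const

lemma hasCompactSupport_pdv {f : R2 → ℂ} (hf : HasCompactSupport f) (v : R2) :
    HasCompactSupport (pdv v f) := hf.fderiv_apply (𝕜 := ℝ) v

lemma pdv_add {f g : R2 → ℂ} {x : R2} (hf : DifferentiableAt ℝ f x)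
    (hg : DifferentiableAt ℝ g x) (v : R2) :
    pdv v (fun y => f y + g y) x = pdv v f x + pdv v g x := by
  simp [pdv, fderiv_fun_add hf hg]

lemma pdv_mul {f g : R2 → ℂ} {x : R2} (hf : DifferentiableAt ℝ f x)
    (hg : DifferentiableAt ℝ g x) (v : R2) :
    pdv v (fun y => f y * g y) x = f x * pdv v g x + pdv v f x * g x := by
  simp [pdv, fderiv_fun_mul hf hg, mul_comm]

lemma pdv_const_mul {f : R2 → ℂ} {x : R2} (hf : DifferentiableAt ℝ f x) (c : ℂ) (v : R2) :
    pdv v (fun y => c * f y) x = c * pdv v f x := by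
  simp [pdv, fderiv_const_mul hf]

lemma pdv_conj {f : R2 → ℂ} {x : R2} (hf : DifferentiableAt ℝ f x) (v : R2) :
    pdv v (fun y => (starRingEnd ℂ) (f y)) x = (starRingEnd ℂ) (pdv v f x) := by
  have h := (Complex.conjCLE.toContinuousLinearMap.hasFDerivAt.comp x hf.hasFDerivAt).fderiv
  have h2 : fderiv ℝ (fun y => (starRingEnd ℂ) (f y)) x
      = (Complex.conjCLE.toContinuousLinearMap).comp (fderiv ℝ f x) := h
  simp [pdv, h2]

/-- the `i`-th coordinate as a complex-valued function -/
def coordC (i : Fin 2) (x : R2) : ℂ := (x i : ℂ)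

lemma hasFDerivAt_coordC (i : Fin 2) (x : R2) : HasFDerivAt (coordC i)
    (Complex.ofRealCLM.comp (EuclideanSpace.proj i : R2 →L[ℝ] ℝ)) x :=
  (Complex.ofRealCLM.comp (EuclideanSpace.proj i : R2 →L[ℝ] ℝ)).hasFDerivAt

lemma contDiff_coordC (i : Fin 2) : ContDiff ℝ (⊤ : ℕ∞) (coordC i) :=
  (Complex.ofRealCLM.comp (EuclideanSpace.proj i : R2 →L[ℝ] ℝ)).contDiff

lemma pdv_coordC (i : Fin 2) (v x : R2) : pdv v (coordC i) x = v i := by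
  simp [pdv, (hasFDerivAt_coordC i x).fderiv]

@[simp] lemma e1_zero : e1 0 = 1 := by simp [e1, mk2]
@[simp] lemma e1_one : e1 1 = 0 := by simp [e1, mk2]
@[simp] lemma e2_zero : e2 0 = 0 := by simp [e2, mk2]
@[simp] lemma e2_one : e2 1 = 1 := by simp [e2, mk2]

lemma zOf_eq (x : R2) : zOf x = coordC 0 x + Complex.I * coordC 1 x := rfl

lemma conj_coordC (i : Fin 2) (x : R2) : (starRingEnd ℂ) (coordC i x) = coordC i x := by
  simp [coordC]

lemma contDiff_zOf : ContDiff ℝ (⊤ : ℕ∞) zOf :=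
  (contDiff_coordC 0).add (contDiff_const.mul (contDiff_coordC 1))

lemma norm_zOf (x : R2) : ‖zOf x‖ = ‖x‖ := by
  rw [EuclideanSpace.norm_eq, ← Real.sqrt_sq (norm_nonneg (zOf x)), ← Complex.normSq_eq_norm_sq]
  congr 1
  simp [zOf, Complex.normSq_apply, Fin.sum_univ_two]
  ring

/-- Complex conjugation preserves smoothness. -/
lemma contDiff_conj {E : Type*} [NormedAddCommGroup E] [NormedSpace ℝ E] {n : WithTop ℕ∞}
    {f : E → ℂ} (hf : ContDiff ℝ n f) : ContDiff ℝ n (fun y => (starRingEnd ℂ) (f y)) :=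
  Complex.conjCLE.contDiff.comp hf

lemma integral_pdv_eq_zero {f : R2 → ℂ} (hf : ContDiff ℝ (⊤ : ℕ∞) f)
    (hc : HasCompactSupport f) (v : R2) : ∫ x, pdv v f x = 0 := by
  have hd : Differentiable ℝ f := hf.differentiable (by simp)
  have h := integral_mul_fderiv_eq_neg_fderiv_mul_of_integrable (μ := (volume : Measure R2))
    (f := fun _ : R2 => (1 : ℂ)) (g := f) (v := v) (by simp)
    (by
      simp only [one_mul]
      exact (contDiff_pdv hf v).continuous.integrable_of_hasCompactSupport
        (hasCompactSupport_pdv hc v))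
    (by simpa using hf.continuous.integrable_of_hasCompactSupport hc)
    (fun x _ => differentiableAt_const _) (fun x _ => hd x)
  simpa [pdv] using h

/-- The Wirtinger derivative `∂/∂z`. -/
def dz (f : R2 → ℂ) (x : R2) : ℂ := (pdv e1 f x - Complex.I * pdv e2 f x) / 2

/-- The Wirtinger derivative `∂/∂z̄`. -/
def dzbar (f : R2 → ℂ) (x : R2) : ℂ := (pdv e1 f x + Complex.I * pdv e2 f x) / 2

/-- `e^{φ} ∂ e^{-φ}` for the weight `φ = κ|z|²` -/
def wDz (κ : ℝ) (f : R2 → ℂ) (x : R2) : ℂ := dz f x - κ * (starRingEnd ℂ) (zOf x) * f x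

/-- `e^{φ} ∂̄ e^{-φ}` for the weight `φ = κ|z|²` -/
def wDzbar (κ : ℝ) (f : R2 → ℂ) (x : R2) : ℂ := dzbar f x - κ * zOf x * f x

/-- minus the formal adjoint of `wDz` -/
def wDzAdj (κ : ℝ) (f : R2 → ℂ) (x : R2) : ℂ := dzbar f x + κ * zOf x * f x

/-- minus the formal adjoint of `wDzbar` -/
def wDzbarAdj (κ : ℝ) (f : R2 → ℂ) (x : R2) : ℂ := dz f x + κ * (starRingEnd ℂ) (zOf x) * f x

/-- smooth functions with compact support -/
structure IsTest (f : R2 → ℂ) : Prop where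
  smooth : ContDiff ℝ (⊤ : ℕ∞) f
  supp : HasCompactSupport f

namespace IsTest

variable {f g : R2 → ℂ}

lemma diffAt (hf : IsTest f) (x : R2) : DifferentiableAt ℝ f x :=
  hf.smooth.differentiable (by simp) x

lemma pdv (hf : IsTest f) (v : R2) : IsTest (pdv v f) :=
  ⟨contDiff_pdv hf.smooth v, hasCompactSupport_pdv hf.supp v⟩

lemma add (hf : IsTest f) (hg : IsTest g) : IsTest (fun x => f x + g x) :=
  ⟨hf.smooth.add hg.smooth, hf.supp.add hg.supp⟩

lemma mul_left (hf : IsTest f) (hg : ContDiff ℝ (⊤ : ℕ∞) g) : IsTest (fun x => g x * f x) :=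
  ⟨hg.mul hf.smooth, hf.supp.mul_left⟩

lemma const_mul (hf : IsTest f) (c : ℂ) : IsTest (fun x => c * f x) :=
  hf.mul_left contDiff_const

lemma conj (hf : IsTest f) : IsTest (fun x => (starRingEnd ℂ) (f x)) :=
  ⟨contDiff_conj hf.smooth, hf.supp.comp_left (map_zero _)⟩

lemma mul (hf : IsTest f) (hg : IsTest g) : IsTest (fun x => f x * g x) := hg.mul_left hf.smooth

lemma dz (hf : IsTest f) : IsTest (dz f) := by
  have := ((hf.pdv e1).add ((hf.pdv e2).const_mul (-Complex.I))).const_mul (1 / 2)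
  have h : _root_.dz f = fun x =>
      1 / 2 * (_root_.pdv e1 f x + (-Complex.I) * _root_.pdv e2 f x) := by
    ext x
    simp only [_root_.dz]
    ring
  rwa [h]

lemma dzbar (hf : IsTest f) : IsTest (dzbar f) := by
  have := ((hf.pdv e1).add ((hf.pdv e2).const_mul Complex.I)).const_mul (1 / 2)
  have h : _root_.dzbar f = fun x =>
      1 / 2 * (_root_.pdv e1 f x + Complex.I * _root_.pdv e2 f x) := by
    ext x
    simp only [_root_.dzbar]
    ring
  rwa [h]

lemma wDzAdj (hf : IsTest f) (κ : ℝ) : IsTest (wDzAdj κ f) :=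
  hf.dzbar.add (hf.mul_left (contDiff_const.mul contDiff_zOf))

lemma wDzbarAdj (hf : IsTest f) (κ : ℝ) : IsTest (wDzbarAdj κ f) :=
  hf.dz.add (hf.mul_left (contDiff_const.mul (contDiff_conj contDiff_zOf)))

lemma wDz (hf : IsTest f) (κ : ℝ) : IsTest (wDz κ f) := by
  have := hf.wDzbarAdj (-κ)
  have h : _root_.wDz κ f = _root_.wDzbarAdj (-κ) f := by
    ext x
    simp only [_root_.wDz, _root_.wDzbarAdj]
    push_cast
    ring
  rwa [h]

lemma wDzbar (hf : IsTest f) (κ : ℝ) : IsTest (wDzbar κ f) := by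
  have := hf.wDzAdj (-κ)
  have h : _root_.wDzbar κ f = _root_.wDzAdj (-κ) f := by
    ext x
    simp only [_root_.wDzbar, _root_.wDzAdj]
    push_cast
    ring
  rwa [h]

lemma integrable (hf : IsTest f) : Integrable f :=
  hf.smooth.continuous.integrable_of_hasCompactSupport hf.supp

lemma integrable_normSq (hf : IsTest f) : Integrable (fun x => normSq (f x)) := by
  have h : Continuous (fun x => normSq (f x)) :=
    Complex.continuous_normSq.comp hf.smooth.continuous
  exact h.integrable_of_hasCompactSupport (hf.supp.comp_left (by simp))

end IsTest

lemma integral_re_pdv_add {h₁ h₂ : R2 → ℂ} (t₁ : IsTest h₁) (t₂ : IsTest h₂) :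
    ∫ x, (pdv e1 h₁ x + pdv e2 h₂ x).re = 0 := by
  have hi : Integrable (fun x => pdv e1 h₁ x + pdv e2 h₂ x) :=
    (t₁.pdv e1).integrable.add (t₂.pdv e2).integrable
  have := integral_re hi
  simp only [RCLike.re_to_complex] at this
  rw [this, integral_add (t₁.pdv e1).integrable (t₂.pdv e2).integrable,
    integral_pdv_eq_zero t₁.smooth t₁.supp, integral_pdv_eq_zero t₂.smooth t₂.supp]
  simp

/-- `∫ |∂f|² = ∫ |∂̄f|²` -/
lemma integral_normSq_dz_sub {f : R2 → ℂ} (hf : IsTest f) :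
    ∫ x, (normSq (dz f x) - normSq (dzbar f x)) = 0 := by
  have t₁ := (hf.mul (hf.pdv e2).conj).const_mul (Complex.I / 2)
  have t₂ := (hf.mul (hf.pdv e1).conj).const_mul (-Complex.I / 2)
  rw [← integral_re_pdv_add t₁ t₂]
  congr 1 with x
  have hsymm : pdv e1 (pdv e2 f) x = pdv e2 (pdv e1 f) x := by
    have hs : IsSymmSndFDerivAt ℝ f x :=
      (hf.smooth.contDiffAt).isSymmSndFDerivAt (by
        rw [minSmoothness_of_isRCLikeNormedField]
        exact WithTop.coe_le_coe.2 (le_top : (2 : ℕ∞) ≤ ⊤))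
    have hd : DifferentiableAt ℝ (fderiv ℝ f) x :=
      ((hf.smooth.fderiv_right (m := (⊤ : ℕ∞)) (by simp)).differentiable (by simp)) x
    have key : ∀ v w : R2, pdv v (pdv w f) x = fderiv ℝ (fderiv ℝ f) x v w := by
      intro v w
      change fderiv ℝ (fun y => fderiv ℝ f y w) x v = _
      rw [fderiv_clm_apply hd (differentiableAt_const _)]
      simp
    rw [key, key]
    exact hs e1 e2
  rw [pdv_const_mul ((hf.mul (hf.pdv e2).conj).diffAt x),
    pdv_const_mul ((hf.mul (hf.pdv e1).conj).diffAt x),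
    pdv_mul (hf.diffAt x) ((hf.pdv e2).conj.diffAt x),
    pdv_mul (hf.diffAt x) ((hf.pdv e1).conj.diffAt x),
    pdv_conj ((hf.pdv e2).diffAt x), pdv_conj ((hf.pdv e1).diffAt x), hsymm]
  simp [dz, dzbar, normSq_apply]
  ring

/-- The pairing of the Euler field with `f` integrates to `-∫ |f|²`. -/
lemma integral_euler {f : R2 → ℂ} (hf : IsTest f) :
    ∫ x, (((starRingEnd ℂ) (f x) * (zOf x * dz f x + (starRingEnd ℂ) (zOf x) * dzbar f x)).re
      + normSq (f x)) = 0 := by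
  have t := hf.mul hf.conj
  have t₁ := ((t.mul_left (contDiff_coordC 0))).const_mul (1 / 2)
  have t₂ := ((t.mul_left (contDiff_coordC 1))).const_mul (1 / 2)
  rw [← integral_re_pdv_add t₁ t₂]
  congr 1 with x
  have hc := fun i => (contDiff_coordC i).differentiable (by simp) x
  rw [pdv_const_mul ((t.mul_left (contDiff_coordC 0)).diffAt x),
    pdv_const_mul ((t.mul_left (contDiff_coordC 1)).diffAt x),
    pdv_mul (hc 0) (t.diffAt x), pdv_mul (hc 1) (t.diffAt x), pdv_coordC, pdv_coordC,
    pdv_mul (hf.diffAt x) (hf.conj.diffAt x), pdv_mul (hf.diffAt x) (hf.conj.diffAt x),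
    pdv_conj (hf.diffAt x), pdv_conj (hf.diffAt x)]
  simp [dz, dzbar, normSq_apply, zOf_eq, coordC]
  ring

lemma integral_cross {f g : R2 → ℂ} (hf : IsTest f) (hg : IsTest g) :
    ∫ x, ((starRingEnd ℂ) (zOf x) *
      (dz f x * (starRingEnd ℂ) (g x) + f x * (starRingEnd ℂ) (dzbar g x))).re = 0 := by
  have t := (hf.mul hg.conj).mul_left (contDiff_conj contDiff_zOf)
  have t₁ := t.const_mul (1 / 2)
  have t₂ := t.const_mul (-Complex.I / 2)
  rw [← integral_re_pdv_add t₁ t₂]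
  congr 1 with x
  have hz : ∀ v : R2, pdv v zOf x = v 0 + Complex.I * v 1 := by
    intro v
    have h : zOf = fun y => coordC 0 y + Complex.I * coordC 1 y := rfl
    have hc := fun i => (contDiff_coordC i).differentiable (by simp) x
    rw [h, pdv_add (hc 0) ((hc 1).const_mul _), pdv_const_mul (hc 1), pdv_coordC, pdv_coordC]
  have hzd : DifferentiableAt ℝ zOf x := contDiff_zOf.differentiable (by simp) x
  have hzc : DifferentiableAt ℝ (fun y => (starRingEnd ℂ) (zOf y)) x :=
    (contDiff_conj contDiff_zOf).differentiable (by simp) x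
  rw [pdv_const_mul (t.diffAt x), pdv_const_mul (t.diffAt x),
    pdv_mul hzc ((hf.mul hg.conj).diffAt x), pdv_mul hzc ((hf.mul hg.conj).diffAt x),
    pdv_mul (hf.diffAt x) (hg.conj.diffAt x), pdv_mul (hf.diffAt x) (hg.conj.diffAt x),
    pdv_conj (hg.diffAt x), pdv_conj (hg.diffAt x), pdv_conj hzd, pdv_conj hzd, hz, hz]
  have hconj : (starRingEnd ℂ) (dzbar g x)
      = ((starRingEnd ℂ) (pdv e1 g x) - Complex.I * (starRingEnd ℂ) (pdv e2 g x)) / 2 := by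
    simp only [dzbar, map_div₀, map_add, map_mul, Complex.conj_I, map_ofNat]
    ring
  rw [hconj]
  simp [dz]
  ring

/-! ### The weighted energy identity -/

/-- the squared `L²` norm -/
def sqNorm (f : R2 → ℂ) : ℝ := ∫ x, normSq (f x)

lemma sqNorm_nonneg (f : R2 → ℂ) : 0 ≤ sqNorm f := integral_nonneg fun _ => normSq_nonneg _

lemma integrable_dz_sub {f : R2 → ℂ} (hf : IsTest f) :
    Integrable (fun x => normSq (dz f x) - normSq (dzbar f x)) :=
  hf.dz.integrable_normSq.sub hf.dzbar.integrable_normSq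

lemma integrable_euler {f : R2 → ℂ} (hf : IsTest f) :
    Integrable (fun x => ((starRingEnd ℂ) (f x) *
      (zOf x * dz f x + (starRingEnd ℂ) (zOf x) * dzbar f x)).re + normSq (f x)) := by
  have t := hf.conj.mul ((hf.dz.mul_left contDiff_zOf).add
    (hf.dzbar.mul_left (contDiff_conj contDiff_zOf)))
  exact t.integrable.re.add hf.integrable_normSq

lemma integrable_cross {f g : R2 → ℂ} (hf : IsTest f) (hg : IsTest g) :
    Integrable (fun x => ((starRingEnd ℂ) (zOf x) *
      (dz f x * (starRingEnd ℂ) (g x) + f x * (starRingEnd ℂ) (dzbar g x))).re) :=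
  (((hf.dz.mul hg.conj).add (hf.mul hg.dzbar.conj)).mul_left
    (contDiff_conj contDiff_zOf)).integrable.re

lemma normSq_add_ge (r : ℝ) (hr : 0 ≤ r) (a b : ℂ) :
    (1 - r) * (normSq a - r * normSq b) ≤ normSq (a + r * b) := by
  have h : normSq (a + r * b) - (1 - r) * (normSq a - r * normSq b) = r * normSq (a + b) := by
    simp [normSq_apply]
    ring
  nlinarith [mul_nonneg hr (normSq_nonneg (a + b))]

/-- The basic weighted estimate for two neighbouring Fourier modes. -/
lemma sqNorm_pair_ge {f g : R2 → ℂ} (hf : IsTest f) (hg : IsTest g) {κ r θ : ℝ} (hκ : 0 ≤ κ)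
    (hr : 0 ≤ r) (hθ : 0 ≤ θ) (hθ1 : θ ≤ 1) :
    sqNorm (wDzAdj κ f) - (r ^ 2 + θ * (1 - r) * r) * sqNorm (wDzbarAdj κ f)
        + 2 * κ * sqNorm f - (1 - θ * (1 - r)) * sqNorm (wDzAdj κ g)
        + r ^ 2 * sqNorm (wDzbarAdj κ g)
      ≤ sqNorm (fun x => wDz κ f x + r * wDzbar κ g x) := by
  have i1 := (hf.wDzAdj κ).integrable_normSq
  have i2 := (hf.wDzbarAdj κ).integrable_normSq
  have i3 := hf.integrable_normSq
  have i4 := (hg.wDzAdj κ).integrable_normSq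
  have i5 := (hg.wDzbarAdj κ).integrable_normSq
  have j1 := integrable_dz_sub hf
  have j2 := integrable_dz_sub hg
  have j3 := integrable_euler hf
  have j4 := integrable_euler hg
  have j5 := integrable_cross hf hg
  have i6 := ((hf.wDz κ).add ((hg.wDzbar κ).const_mul r)).integrable_normSq
  set F1 := fun x => normSq (wDzAdj κ f x)
  set F2 := fun x => normSq (wDzbarAdj κ f x)
  set F3 := fun x => normSq (f x)
  set F4 := fun x => normSq (wDzAdj κ g x)
  set F5 := fun x => normSq (wDzbarAdj κ g x)
  set G1 := fun x => normSq (dz f x) - normSq (dzbar f x) with hG1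
  set G2 := fun x => normSq (dz g x) - normSq (dzbar g x) with hG2
  set G3 := fun x => ((starRingEnd ℂ) (f x) *
      (zOf x * dz f x + (starRingEnd ℂ) (zOf x) * dzbar f x)).re + normSq (f x) with hG3
  set G4 := fun x => ((starRingEnd ℂ) (g x) *
      (zOf x * dz g x + (starRingEnd ℂ) (zOf x) * dzbar g x)).re + normSq (g x) with hG4
  set G5 := fun x => ((starRingEnd ℂ) (zOf x) *
      (dz f x * (starRingEnd ℂ) (g x) + f x * (starRingEnd ℂ) (dzbar g x))).re with hG5
  have hpt : ∀ x, F1 x + (-(r ^ 2 + θ * (1 - r) * r)) * F2 x + 2 * κ * F3 x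
      + (-(1 - θ * (1 - r))) * F4 x + r ^ 2 * F5 x
      + G1 x + (-r ^ 2) * G2 x + (-2 * κ) * G3 x + (-2 * κ * r ^ 2) * G4 x
      + (-4 * r * κ) * G5 x ≤ normSq (wDz κ f x + r * wDzbar κ g x) := by
    intro x
    have hident : normSq (wDz κ f x + r * wDzbar κ g x)
        = normSq (wDzAdj κ g x + r * wDzbarAdj κ f x) + F1 x - r ^ 2 * F2 x + r ^ 2 * F5 x - F4 x
          + 2 * κ * F3 x + 2 * κ * r ^ 2 * normSq (g x)
          + G1 x + (-r ^ 2) * G2 x + (-2 * κ) * G3 x + (-2 * κ * r ^ 2) * G4 x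
          + (-4 * r * κ) * G5 x := by
      simp only [F1, F2, F3, F4, F5, G1, G2, G3, G4, G5, wDz, wDzbar, wDzAdj, wDzbarAdj]
      generalize dz f x = a
      generalize dzbar f x = a'
      generalize dz g x = b
      generalize dzbar g x = b'
      generalize zOf x = z
      generalize f x = u
      generalize g x = w
      simp [normSq_apply]
      ring
    have h1 := normSq_add_ge r hr (wDzAdj κ g x) (wDzbarAdj κ f x)
    have h2 : θ * ((1 - r) * (F4 x - r * F2 x)) ≤ normSq (wDzAdj κ g x + r * wDzbarAdj κ f x) := by
      have h3 := normSq_nonneg (wDzAdj κ g x + r * wDzbarAdj κ f x)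
      calc θ * ((1 - r) * (F4 x - r * F2 x))
          ≤ θ * normSq (wDzAdj κ g x + r * wDzbarAdj κ f x) :=
            mul_le_mul_of_nonneg_left h1 hθ
        _ ≤ 1 * normSq (wDzAdj κ g x + r * wDzbarAdj κ f x) :=
            mul_le_mul_of_nonneg_right hθ1 h3
        _ = _ := one_mul _
    have h4 : 0 ≤ 2 * κ * r ^ 2 * normSq (g x) := by
      have := normSq_nonneg (g x)
      positivity
    rw [hident]
    linarith
  have hint := integral_mono (by fun_prop) i6 hpt
  rw [integral_add (by fun_prop) (by fun_prop), integral_add (by fun_prop) (by fun_prop),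
    integral_add (by fun_prop) (by fun_prop), integral_add (by fun_prop) (by fun_prop),
    integral_add (by fun_prop) (by fun_prop), integral_add (by fun_prop) (by fun_prop),
    integral_add (by fun_prop) (by fun_prop), integral_add (by fun_prop) (by fun_prop),
    integral_add (by fun_prop) (by fun_prop)] at hint
  simp only [integral_const_mul] at hint
  have k1 : ∫ x, G1 x = 0 := integral_normSq_dz_sub hf
  have k2 : ∫ x, G2 x = 0 := integral_normSq_dz_sub hg
  have k3 : ∫ x, G3 x = 0 := integral_euler hf
  have k4 : ∫ x, G4 x = 0 := integral_euler hg
  have k5 : ∫ x, G5 x = 0 := integral_cross hf hg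
  rw [k1, k2, k3, k4, k5] at hint
  simp only [sqNorm]
  linarith

/-- The two adjoint derivatives have comparable norms. -/
lemma sqNorm_wDzbarAdj_le {f : R2 → ℂ} (hf : IsTest f) {κ R ε : ℝ} (hκ : 0 ≤ κ) (hε : 0 < ε)
    (hsupp : ∀ x, R ≤ ‖x‖ → f x = 0) :
    sqNorm (wDzbarAdj κ f) ≤ sqNorm (wDzAdj κ f)
      + ε * (sqNorm (wDzAdj κ f) + sqNorm (wDzbarAdj κ f))
      + 2 * κ ^ 2 * R ^ 2 / ε * sqNorm f := by
  have i1 := (hf.wDzAdj κ).integrable_normSq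
  have i2 := (hf.wDzbarAdj κ).integrable_normSq
  have i3 := hf.integrable_normSq
  have j1 := integrable_dz_sub hf
  set F1 := fun x => normSq (wDzAdj κ f x) with hF1
  set F2 := fun x => normSq (wDzbarAdj κ f x) with hF2
  set F3 := fun x => normSq (f x) with hF3
  set G1 := fun x => normSq (dz f x) - normSq (dzbar f x) with hG1
  have hpt : ∀ x, F2 x ≤ F1 x + ε * F1 x + ε * F2 x + 2 * κ ^ 2 * R ^ 2 / ε * F3 x + G1 x := by
    intro x
    have hid : F2 x = F1 x + G1 x + 2 * κ * ((starRingEnd ℂ) (f x) *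
        (zOf x * wDzbarAdj κ f x - (starRingEnd ℂ) (zOf x) * wDzAdj κ f x)).re := by
      simp only [F1, F2, G1, wDzAdj, wDzbarAdj]
      generalize dz f x = a
      generalize dzbar f x = a'
      generalize zOf x = z
      generalize f x = u
      simp [normSq_apply]
      ring
    have hb : 2 * κ * ((starRingEnd ℂ) (f x) *
        (zOf x * wDzbarAdj κ f x - (starRingEnd ℂ) (zOf x) * wDzAdj κ f x)).re
        ≤ ε * F1 x + ε * F2 x + 2 * κ ^ 2 * R ^ 2 / ε * F3 x := by
      simp only [F1, F2, F3, normSq_eq_norm_sq]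
      rcases le_or_gt R ‖x‖ with hx | hx
      · simp only [hsupp x hx, map_zero, zero_mul, Complex.zero_re, mul_zero, norm_zero]
        positivity
      · have hn : ((starRingEnd ℂ) (f x) *
            (zOf x * wDzbarAdj κ f x - (starRingEnd ℂ) (zOf x) * wDzAdj κ f x)).re
            ≤ ‖f x‖ * (R * ‖wDzbarAdj κ f x‖ + R * ‖wDzAdj κ f x‖) := by
          refine (Complex.re_le_norm _).trans ?_
          rw [norm_mul, RCLike.norm_conj]
          refine mul_le_mul_of_nonneg_left ((norm_sub_le _ _).trans ?_) (norm_nonneg _)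
          rw [norm_mul, norm_mul, RCLike.norm_conj, norm_zOf]
          gcongr
        refine (mul_le_mul_of_nonneg_left hn (by positivity)).trans ?_
        generalize ‖f x‖ = u
        generalize ‖wDzbarAdj κ f x‖ = p
        generalize ‖wDzAdj κ f x‖ = q
        have e1 : ε * q ^ 2 + ε * p ^ 2 + 2 * κ ^ 2 * R ^ 2 / ε * u ^ 2
            - 2 * κ * (u * (R * p + R * q))
            = (ε * p - κ * R * u) ^ 2 / ε + (ε * q - κ * R * u) ^ 2 / ε := by
          field_simp
          ring
        have e2 : 0 ≤ (ε * p - κ * R * u) ^ 2 / ε + (ε * q - κ * R * u) ^ 2 / ε := by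
          positivity
        linarith
    linarith
  have hint := integral_mono i2 (by fun_prop) hpt
  rw [integral_add (by fun_prop) (by fun_prop), integral_add (by fun_prop) (by fun_prop),
    integral_add (by fun_prop) (by fun_prop), integral_add (by fun_prop) (by fun_prop)] at hint
  simp only [integral_const_mul] at hint
  have k1 : ∫ x, G1 x = 0 := integral_normSq_dz_sub hf
  rw [k1] at hint
  simp only [sqNorm]
  linarith

/-! ### Summation of the weighted estimates over all modes -/

lemma comparable_of_angular {S T n M ε : ℝ} (hS : 0 ≤ S) (hn : 0 ≤ n)
    (hM : 0 ≤ M) (hε : 0 < ε) (hε1 : ε ≤ 1 / 2) (h : T ≤ S + ε * (S + T) + M / ε * n) :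
    T ≤ (1 + 4 * ε) * S + 2 * M / ε * n := by
  have hMn : 0 ≤ M / ε * n := by positivity
  have e : 2 * M / ε * n = 2 * (M / ε * n) := by ring
  rw [e]
  by_contra! hc
  nlinarith [mul_nonneg hS (mul_nonneg hε.le (sub_nonneg.2 hε1)),
    mul_nonneg hMn (sub_nonneg.2 hε1)]

/-- The diagonal contribution of a mode is bounded below. -/
lemma net_ge {x N κ R θ S T n : ℝ} (hx : 1 ≤ x) (hN : 16 ≤ θ * N) (hκ : 0 < κ)
    (hθ : 0 < θ) (hθ1 : θ ≤ 1) (hθ2 : 256 * κ * R ^ 2 * θ ≤ 1) (hS : 0 ≤ S)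
    (hn : 0 ≤ n)
    (h : ∀ ε : ℝ, 0 < ε → T ≤ S + ε * (S + T) + 2 * κ ^ 2 * R ^ 2 / ε * n) :
    -(κ / 2) * n ≤ θ * (N / (x - 1 + N)) * S
      - (((x + 1) / (x + 1 + N)) ^ 2 - ((x - 1) / (x - 1 + N)) ^ 2
        + θ * (N / (x + 1 + N)) * ((x + 1) / (x + 1 + N))) * T := by
  have hN16 : 16 ≤ N := by
    by_contra! hc
    nlinarith
  have p1 : 0 < x - 1 + N := by linarith
  have p2 : 0 < x + 1 + N := by linarith
  set d := N / (x + 1 + N) with hd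
  set d' := N / (x - 1 + N) with hd'
  have r1 : (x + 1) / (x + 1 + N) = 1 - d := by
    rw [hd]
    field_simp
    ring
  have r2 : (x - 1) / (x - 1 + N) = 1 - d' := by
    rw [hd']
    field_simp
    ring
  have hdd : d' - d = 2 / N * (d' * d) := by
    rw [hd, hd']
    field_simp
    ring
  have d0 : 0 < d := by positivity
  have d'0 : 0 < d' := by positivity
  have d1 : d ≤ 1 := by
    rw [hd, div_le_one p2]
    linarith
  have d'1 : d' ≤ 1 := by
    rw [hd', div_le_one p1]
    linarith
  have d'2 : d' ≤ 2 * d := by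
    rw [hd, hd', ← mul_div_assoc, div_le_div_iff₀ p1 p2]
    nlinarith
  have hdle : d ≤ d' := by
    have : 0 ≤ 2 / N * (d' * d) := by positivity
    linarith
  rw [r1, r2]
  set b := (1 - d) ^ 2 - (1 - d') ^ 2 + θ * d * (1 - d) with hb
  have hNinv : 2 / N ≤ θ / 8 := by
    rw [div_le_div_iff₀ (by linarith) (by norm_num)]
    linarith
  have hgap : d' - d ≤ θ / 4 * d ^ 2 := by
    rw [hdd]
    calc 2 / N * (d' * d) ≤ θ / 8 * (2 * d * d) := by gcongr
      _ = θ / 4 * d ^ 2 := by ring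
  have hfirst : (1 - d) ^ 2 - (1 - d') ^ 2 ≤ 2 * (d' - d) := by nlinarith
  have hfirst0 : 0 ≤ (1 - d) ^ 2 - (1 - d') ^ 2 := by nlinarith
  have hb0 : 0 ≤ b := by
    have : 0 ≤ θ * d * (1 - d) := by
      have := sub_nonneg.2 d1
      positivity
    linarith
  have hab : θ * d ^ 2 / 2 ≤ θ * d' - b := by
    have : θ * d ≤ θ * d' := by gcongr
    nlinarith
  have hb2 : b ≤ 2 * θ * d := by
    have : d ^ 2 ≤ d := by nlinarith
    nlinarith [mul_nonneg hθ.le d0.le, mul_nonneg hθ.le (sub_nonneg.2 this)]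
  have hT' := comparable_of_angular hS hn (M := 2 * κ ^ 2 * R ^ 2) (by positivity)
    (ε := d / 16) (by positivity) (by linarith) (h _ (by positivity))
  have hbT := mul_le_mul_of_nonneg_left hT' hb0
  have hexp : b * ((1 + 4 * (d / 16)) * S + 2 * (2 * κ ^ 2 * R ^ 2) / (d / 16) * n)
      = b * S + b * d / 4 * S + b / d * (64 * κ ^ 2 * R ^ 2 * n) := by
    field_simp
    ring
  have hbd : b / d ≤ 2 * θ := by
    rw [div_le_iff₀ d0]
    exact hb2
  have t1 : b / d * (64 * κ ^ 2 * R ^ 2 * n) ≤ κ / 2 * n := by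
    calc b / d * (64 * κ ^ 2 * R ^ 2 * n) ≤ 2 * θ * (64 * κ ^ 2 * R ^ 2 * n) := by gcongr
      _ = (256 * κ * R ^ 2 * θ) * (κ / 2 * n) := by ring
      _ ≤ 1 * (κ / 2 * n) := by gcongr
      _ = κ / 2 * n := one_mul _
  have hbd2 : b * d / 4 ≤ θ * d ^ 2 / 2 := by
    have := mul_le_mul_of_nonneg_right hb2 d0.le
    linarith [show 2 * θ * d * d = 2 * (θ * d ^ 2) by ring]
  have t2 := mul_le_mul_of_nonneg_right hbd2 hS
  have t3 := mul_le_mul_of_nonneg_right hab hS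
  linarith

/-- The boundary terms at the lowest modes are bounded below. -/
lemma boundary_ge {x N κ R θ S T n : ℝ} (hx : 0 ≤ x) (hx1 : x ≤ 1) (hN : 16 ≤ θ * N)
    (hκ : 0 < κ) (hθ : 0 < θ) (hθ1 : θ ≤ 1 / 2) (hθ2 : 256 * κ * R ^ 2 * θ ≤ 1) (hS : 0 ≤ S)
    (hn : 0 ≤ n)
    (h : ∀ ε : ℝ, 0 < ε → T ≤ S + ε * (S + T) + 2 * κ ^ 2 * R ^ 2 / ε * n) :
    -(κ / 2) * n ≤ (1 - θ * (N / (x + N))) * S - (x / (x + N)) ^ 2 * T := by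
  have hN16 : 16 ≤ N := by
    by_contra! hc
    nlinarith
  have p : 0 < x + N := by linarith
  have hd1 : N / (x + N) ≤ 1 := by
    rw [div_le_one p]
    linarith
  have hr0 : 0 ≤ x / (x + N) := by positivity
  have hr1 : x / (x + N) ≤ θ / 16 := by
    rw [div_le_div_iff₀ p (by norm_num)]
    nlinarith
  set r := x / (x + N)
  have hrr : r ^ 2 ≤ θ / 16 := by nlinarith
  have hT' := comparable_of_angular hS hn (M := 2 * κ ^ 2 * R ^ 2) (by positivity)
    (ε := 1 / 2) (by positivity) le_rfl (h _ (by positivity))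
  have h1 := mul_le_mul_of_nonneg_left hT' (sq_nonneg r)
  have h2 : r ^ 2 * ((1 + 4 * (1 / 2)) * S + 2 * (2 * κ ^ 2 * R ^ 2) / (1 / 2) * n)
      ≤ θ / 16 * ((1 + 4 * (1 / 2)) * S + 2 * (2 * κ ^ 2 * R ^ 2) / (1 / 2) * n) := by
    gcongr
  have h3 : θ / 16 * (2 * (2 * κ ^ 2 * R ^ 2) / (1 / 2) * n)
      = (256 * κ * R ^ 2 * θ) * (κ / 512 * n) := by ring
  have h4 : (256 * κ * R ^ 2 * θ) * (κ / 512 * n) ≤ 1 * (κ / 512 * n) := by gcongr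
  have h5 : (1 / 2) * S ≤ (1 - θ * (N / (x + N))) * S := by
    gcongr
    nlinarith
  have h6 : θ / 16 * S ≤ 1 / 32 * S := mul_le_mul_of_nonneg_right (by linarith) hS
  nlinarith [mul_nonneg hκ.le hn]

/-- Summing the pair estimates over all modes forces every mode to vanish. -/
lemma modes_eq_zero {n S T Y : ℕ → ℝ} {N κ R θ C : ℝ} (hC : 0 ≤ C) (hκ : 3 * C < κ)
    (hN : 16 ≤ θ * N) (hθ : 0 < θ) (hθ1 : θ ≤ 1 / 2) (hθ2 : 256 * κ * R ^ 2 * θ ≤ 1)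
    (hn : ∀ j, 0 ≤ n j) (hS : ∀ j, 0 ≤ S j) (hT : ∀ j, 0 ≤ T j)
    (hang : ∀ j, ∀ ε : ℝ, 0 < ε → T j ≤ S j + ε * (S j + T j) + 2 * κ ^ 2 * R ^ 2 / ε * n j)
    (hpair : ∀ j : ℕ, S j - ((((j : ℝ) + 2) / (j + 2 + N)) ^ 2
        + θ * (N / (j + 2 + N)) * (((j : ℝ) + 2) / (j + 2 + N))) * T j + 2 * κ * n j
        - (1 - θ * (N / (j + 2 + N))) * S (j + 2)
        + (((j : ℝ) + 2) / (j + 2 + N)) ^ 2 * T (j + 2) ≤ Y j)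
    (hY : ∀ j, Y j ≤ C * (n j + n (j + 1) + n (j + 2)))
    (hn0 : Tendsto n atTop (𝓝 0)) (hS0 : Tendsto S atTop (𝓝 0)) (j : ℕ) : n j = 0 := by
  have hκ0 : 0 < κ := by linarith
  have hN16 : 16 ≤ N := by
    by_contra! hc
    nlinarith
  set Φ : ℕ → ℝ := fun j => (1 - θ * (N / (j + N))) * S j - ((j : ℝ) / (j + N)) ^ 2 * T j with hΦ
  have hΦle : ∀ j, Φ j ≤ S j := by
    intro j
    have h1 : 0 ≤ θ * (N / (j + N)) * S j := by
      have := hS j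
      positivity
    have h2 : 0 ≤ ((j : ℝ) / (j + N)) ^ 2 * T j := by
      have := hT j
      positivity
    simp only [hΦ]
    linarith
  have hstep : ∀ j, 3 / 2 * κ * n j + Φ j - Φ (j + 2) ≤ C * (n j + n (j + 1) + n (j + 2)) := by
    intro j
    have h1 := net_ge (x := (j : ℝ) + 1) (by linarith [Nat.cast_nonneg (α := ℝ) j]) hN hκ0 hθ
      (by linarith) hθ2 (hS j) (hn j) (hang j)
    have h2 := hpair j
    have h3 := hY j
    have e1 : (j : ℝ) + 1 - 1 = j := by ring
    have e2 : (j : ℝ) + 1 + 1 = j + 2 := by ring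
    rw [e1, e2] at h1
    simp only [hΦ]
    push_cast
    linarith
  have hb0 := boundary_ge (x := 0) le_rfl zero_le_one hN hκ0 hθ hθ1 hθ2 (hS 0) (hn 0)
    (hang 0)
  have hb1 := boundary_ge (x := 1) zero_le_one le_rfl hN hκ0 hθ hθ1 hθ2 (hS 1) (hn 1)
    (hang 1)
  have hsum : ∀ J : ℕ, (3 / 2 * κ - 3 * C) * ∑ i ∈ Finset.range J, n i + Φ 0 + Φ 1
      ≤ Φ J + Φ (J + 1) + C * (2 * n J + n (J + 1)) := by
    have aux : ∀ J : ℕ, (3 / 2 * κ - 3 * C) * ∑ i ∈ Finset.range J, n i + Φ 0 + Φ 1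
        + C * (2 * n 0 + n 1) ≤ Φ J + Φ (J + 1) + C * (2 * n J + n (J + 1)) := by
      intro J
      induction J with
      | zero => simp
      | succ J ih =>
        rw [Finset.sum_range_succ]
        have := hstep J
        nlinarith
    intro J
    have := aux J
    have h0 : 0 ≤ C * (2 * n 0 + n 1) := by
      have := hn 0
      have := hn 1
      positivity
    linarith
  have hbound : ∀ J : ℕ, 2 ≤ J → (κ - 3 * C) * ∑ i ∈ Finset.range J, n i
      ≤ S J + S (J + 1) + C * (2 * n J + n (J + 1)) := by
    intro J hJ
    have h1 := hsum J
    have h2 := hΦle J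
    have h3 := hΦle (J + 1)
    have h4 : n 0 + n 1 ≤ ∑ i ∈ Finset.range J, n i := by
      have : ∑ i ∈ Finset.range 2, n i ≤ ∑ i ∈ Finset.range J, n i :=
        Finset.sum_le_sum_of_subset_of_nonneg (Finset.range_mono hJ) fun i _ _ => hn i
      simpa [Finset.sum_range_succ] using this
    have h5 : -(κ / 2) * n 0 ≤ Φ 0 := by simpa [hΦ] using hb0
    have h6 : -(κ / 2) * n 1 ≤ Φ 1 := by simpa [hΦ] using hb1
    nlinarith
  have hlim : Tendsto (fun J => S J + S (J + 1) + C * (2 * n J + n (J + 1))) atTop (𝓝 0) := by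
    have a1 := hS0.comp (tendsto_add_atTop_nat 1)
    have a2 := hn0.comp (tendsto_add_atTop_nat 1)
    simpa using (hS0.add a1).add (((hn0.const_mul 2).add a2).const_mul C)
  have hle : (κ - 3 * C) * n j ≤ 0 := by
    refine ge_of_tendsto hlim ?_
    filter_upwards [eventually_ge_atTop (j + 2)] with J hJ
    refine le_trans ?_ (hbound J (by omega))
    refine mul_le_mul_of_nonneg_left ?_ (by linarith)
    exact Finset.single_le_sum (fun i _ => hn i) (Finset.mem_range.2 (by omega))
  have := hn j
  nlinarith

/-! ### The Carleman estimate for sequences of modes -/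

/-- the Gaussian weight `e^{κ|z|²}` -/
def gaussC (κ : ℝ) (x : R2) : ℂ :=
  cexp (κ * (coordC 0 x * coordC 0 x + coordC 1 x * coordC 1 x))

lemma contDiff_gaussC (κ : ℝ) : ContDiff ℝ (⊤ : ℕ∞) (gaussC κ) :=
  (contDiff_const.mul (((contDiff_coordC 0).mul (contDiff_coordC 0)).add
    ((contDiff_coordC 1).mul (contDiff_coordC 1)))).cexp

lemma norm_gaussC (κ : ℝ) (x : R2) : ‖gaussC κ x‖ = Real.exp (κ * ‖x‖ ^ 2) := by
  rw [gaussC, Complex.norm_exp, EuclideanSpace.norm_sq_eq, Fin.sum_univ_two]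
  congr 1
  simp only [coordC, Real.norm_eq_abs, sq_abs]
  norm_cast
  ring

lemma pdv_gaussC (κ : ℝ) (v x : R2) :
    pdv v (gaussC κ) x = gaussC κ x * (2 * κ * (coordC 0 x * v 0 + coordC 1 x * v 1)) := by
  have h := (((hasFDerivAt_coordC 0 x).mul (hasFDerivAt_coordC 0 x)).add
    ((hasFDerivAt_coordC 1 x).mul (hasFDerivAt_coordC 1 x))).const_mul (κ : ℂ)
  have h2 := h.cexp.fderiv
  have h3 : fderiv ℝ (gaussC κ) x = _ := h2
  rw [pdv, h3]
  simp [gaussC]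
  ring

lemma pdv_gaussC_mul {w : R2 → ℂ} {x : R2} (hw : DifferentiableAt ℝ w x) (κ : ℝ) (q : ℂ)
    (v : R2) : pdv v (fun y => q * (gaussC κ y * w y)) x
      = q * gaussC κ x * (pdv v w x + 2 * κ * (coordC 0 x * v 0 + coordC 1 x * v 1) * w x) := by
  have hg : DifferentiableAt ℝ (gaussC κ) x := (contDiff_gaussC κ).differentiable (by simp) x
  rw [pdv_const_mul (hg.fun_mul hw), pdv_mul hg hw, pdv_gaussC]
  ring

lemma wDz_gaussC_mul {w : R2 → ℂ} {x : R2} (hw : DifferentiableAt ℝ w x) (κ : ℝ) (q : ℂ) :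
    wDz κ (fun y => q * (gaussC κ y * w y)) x = q * (gaussC κ x * dz w x) := by
  simp only [wDz, dz, pdv_gaussC_mul hw, zOf_eq, map_add, map_mul, conj_coordC, conj_I,
    e1_zero, e1_one, e2_zero, e2_one]
  push_cast
  ring

lemma wDzbar_gaussC_mul {w : R2 → ℂ} {x : R2} (hw : DifferentiableAt ℝ w x) (κ : ℝ) (q : ℂ) :
    wDzbar κ (fun y => q * (gaussC κ y * w y)) x = q * (gaussC κ x * dzbar w x) := by
  simp only [wDzbar, dzbar, pdv_gaussC_mul hw, zOf_eq, e1_zero, e1_one, e2_zero, e2_one]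
  push_cast
  ring

lemma wDzAdj_gaussC_mul {w : R2 → ℂ} {x : R2} (hw : DifferentiableAt ℝ w x) (κ : ℝ) (q : ℂ) :
    wDzAdj κ (fun y => q * (gaussC κ y * w y)) x
      = q * (gaussC κ x * (dzbar w x + 2 * κ * zOf x * w x)) := by
  simp only [wDzAdj, dzbar, pdv_gaussC_mul hw, zOf_eq, e1_zero, e1_one, e2_zero, e2_one]
  push_cast
  ring

lemma isTest_of_eq_zero {f : R2 → ℂ} {R : ℝ} (hf : ContDiff ℝ (⊤ : ℕ∞) f)
    (h : ∀ x, R ≤ ‖x‖ → f x = 0) : IsTest f :=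
  ⟨hf, HasCompactSupport.intro (isCompact_closedBall 0 R) fun x hx => h x (by
    simp only [Metric.mem_closedBall, dist_zero_right, not_le] at hx
    exact hx.le)⟩

lemma pdv_eq_zero_of_norm_gt {f : R2 → ℂ} {R : ℝ} (h : ∀ x, R ≤ ‖x‖ → f x = 0) {x : R2}
    (hx : R < ‖x‖) (v : R2) : pdv v f x = 0 := by
  have : f =ᶠ[𝓝 x] fun _ => 0 := by
    filter_upwards [continuous_norm.continuousAt.eventually_const_lt hx] with y hy
    exact h y hy.le
  simp [pdv, this.fderiv_eq]

lemma sqNorm_le_of_bound {f : R2 → ℂ} {R D : ℝ}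
    (h0 : ∀ x, R < ‖x‖ → f x = 0) (hb : ∀ x, ‖x‖ ≤ R → ‖f x‖ ≤ D) :
    sqNorm f ≤ D ^ 2 * volume.real (Metric.closedBall (0 : R2) R) := by
  have hfin : volume (Metric.closedBall (0 : R2) R) < ⊤ := measure_closedBall_lt_top
  have h1 : sqNorm f = ∫ x in Metric.closedBall (0 : R2) R, normSq (f x) := by
    refine (setIntegral_eq_integral_of_forall_compl_eq_zero fun x hx => ?_).symm
    simp only [Metric.mem_closedBall, dist_zero_right, not_le] at hx
    simp [h0 x hx]
  rw [h1]
  refine (Real.le_norm_self _).trans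
    (norm_setIntegral_le_of_norm_le_const hfin fun x hx => ?_)
  rw [Real.norm_of_nonneg (normSq_nonneg _), normSq_eq_norm_sq]
  have := hb x (by simpa using hx)
  gcongr

/-- `∏_{i<n} (j + 2 + 2 i)`, the weight of the `j`-th mode -/
def modeWeight (n j : ℕ) : ℝ := ∏ i ∈ Finset.range n, ((j : ℝ) + 2 + 2 * i)

lemma modeWeight_pos (n j : ℕ) : 0 < modeWeight n j :=
  Finset.prod_pos fun i _ => by positivity

lemma modeWeight_mono (n : ℕ) : Monotone (modeWeight n) := by
  intro j k hjk
  refine Finset.prod_le_prod (fun i _ => by positivity) fun i _ => ?_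
  have : (j : ℝ) ≤ k := by exact_mod_cast hjk
  linarith

lemma modeWeight_ratio (n j : ℕ) :
    modeWeight n j = ((j : ℝ) + 2) / (j + 2 + 2 * n) * modeWeight n (j + 2) := by
  rw [div_mul_eq_mul_div, eq_div_iff (by positivity)]
  induction n with
  | zero => simp [modeWeight]
  | succ n ih =>
    simp only [modeWeight, Finset.prod_range_succ] at ih ⊢
    push_cast at ih ⊢
    linear_combination ((j : ℝ) + 2 + 2 + 2 * n) * ih

lemma modeWeight_le (n j : ℕ) : modeWeight n j ≤ (2 * n + 2) ^ n * ((j : ℝ) + 1) ^ n := by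
  rw [← mul_pow]
  calc modeWeight n j ≤ ∏ _i ∈ Finset.range n, ((2 * n + 2) * ((j : ℝ) + 1)) := by
        refine Finset.prod_le_prod (fun i _ => by positivity) fun i hi => ?_
        have h1 : (i : ℝ) ≤ n := by exact_mod_cast (Finset.mem_range.1 hi).le
        have h2 : (0 : ℝ) ≤ n * j := by positivity
        nlinarith [Nat.cast_nonneg (α := ℝ) j]
    _ = ((2 * n + 2) * ((j : ℝ) + 1)) ^ n := by simp

lemma tendsto_sqNorm_zero {f : ℕ → R2 → ℂ} {R D : ℝ}
    (h0 : ∀ j x, R < ‖x‖ → f j x = 0)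
    (hb : ∀ (j : ℕ) x, ‖x‖ ≤ R → ((j : ℝ) + 1) * ‖f j x‖ ≤ D) :
    Tendsto (fun j => sqNorm (f j)) atTop (𝓝 0) := by
  have h1 : ∀ j, sqNorm (f j) ≤ (D * (1 / ((j : ℝ) + 1))) ^ 2 *
      volume.real (Metric.closedBall (0 : R2) R) := fun j =>
    sqNorm_le_of_bound (h0 j) fun x hx => by
      rw [mul_one_div, le_div_iff₀ (by positivity), mul_comm]
      exact hb j x hx
  have h2 : Tendsto (fun j : ℕ => (D * (1 / ((j : ℝ) + 1))) ^ 2 *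
      volume.real (Metric.closedBall (0 : R2) R)) atTop (𝓝 0) := by
    have := (((tendsto_one_div_add_atTop_nhds_zero_nat (𝕜 := ℝ)).const_mul D).pow 2).mul_const
      (volume.real (Metric.closedBall (0 : R2) R))
    simpa using this
  exact squeeze_zero (fun j => sqNorm_nonneg _) h1 h2

lemma eq_zero_of_sqNorm_eq_zero {f : R2 → ℂ} (hf : IsTest f) (h : sqNorm f = 0) (x : R2) :
    f x = 0 := by
  have hc : Continuous fun y => normSq (f y) := Complex.continuous_normSq.comp hf.smooth.continuous
  have := (hc.integral_pos_of_hasCompactSupport_nonneg_nonzero (μ := volume) (x := x)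
    (hf.supp.comp_left (by simp)) fun y => normSq_nonneg _)
  by_contra hx
  have h3 := this (by simpa using hx)
  simp only [sqNorm] at h
  linarith

lemma sq_sum_three_le {ι : Type*} [Fintype ι] (a b c : ι → ℝ) :
    (∑ l, (a l + b l + c l)) ^ 2
      ≤ 3 * Fintype.card ι * ∑ l, (a l ^ 2 + b l ^ 2 + c l ^ 2) := by
  have h := sq_sum_le_card_mul_sum_sq (s := Finset.univ) (f := fun l => a l + b l + c l)
  refine h.trans ?_
  rw [Finset.card_univ, mul_comm (3 : ℝ), mul_assoc, Finset.mul_sum _ _ (3 : ℝ)]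
  gcongr with l
  nlinarith [sq_nonneg (a l - b l), sq_nonneg (b l - c l), sq_nonneg (a l - c l)]

/-- A rapidly decreasing sequence of compactly supported modes solving the recursive
differential inequality vanishes. -/
theorem modes_unique_continuation {ι : Type*} [Fintype ι] {w : ι → ℕ → R2 → ℂ} {R C : ℝ}
    (hR : 0 < R) (hC : 0 ≤ C) (hsm : ∀ l j, ContDiff ℝ (⊤ : ℕ∞) (w l j))
    (hsupp : ∀ l j x, R ≤ ‖x‖ → w l j x = 0)
    (hdec : ∀ n : ℕ, ∃ D : ℝ, ∀ l (j : ℕ) x, ((j : ℝ) + 1) ^ n * ‖w l j x‖ ≤ D ∧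
      ((j : ℝ) + 1) ^ n * ‖dzbar (w l j) x‖ ≤ D)
    (hsys : ∀ l j x, ‖dz (w l j) x + dzbar (w l (j + 2)) x‖
      ≤ C * ∑ l', (‖w l' j x‖ + ‖w l' (j + 1) x‖ + ‖w l' (j + 2) x‖))
    (l : ι) (j : ℕ) (x : R2) : w l j x = 0 := by
  set c : ℝ := (Fintype.card ι : ℝ) with hc
  have hc0 : 0 ≤ c := Nat.cast_nonneg _
  set C' : ℝ := c * (C ^ 2 * (3 * c)) with hC'
  have hC'0 : 0 ≤ C' := by positivity
  set κ : ℝ := 3 * C' + 1 with hκ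
  have hκ0 : 0 < κ := by positivity
  set θ : ℝ := min (1 / 2) (1 / (256 * κ * R ^ 2)) with hθ
  have hθ0 : 0 < θ := lt_min (by norm_num) (by positivity)
  have hθ2 : 256 * κ * R ^ 2 * θ ≤ 1 := by
    have : θ ≤ 1 / (256 * κ * R ^ 2) := min_le_right _ _
    rwa [le_div_iff₀ (by positivity), mul_comm] at this
  obtain ⟨n, hn⟩ := exists_nat_ge (8 / θ)
  have hN : 16 ≤ θ * (2 * n) := by
    rw [div_le_iff₀ hθ0] at hn
    linarith
  set Q := modeWeight n with hQ
  have hQ0 : ∀ j, 0 < Q j := modeWeight_pos n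
  set p : ι → ℕ → R2 → ℂ := fun l j y => (Q j : ℂ) * (gaussC κ y * w l j y) with hp
  have hdiff : ∀ l j x, DifferentiableAt ℝ (w l j) x := fun l j x =>
    (hsm l j).differentiable (by simp) x
  have hpsupp : ∀ l j x, R ≤ ‖x‖ → p l j x = 0 := fun l j x hx => by
    simp [hp, hsupp l j x hx]
  have hpt : ∀ l j, IsTest (p l j) := fun l j =>
    isTest_of_eq_zero (contDiff_const.mul ((contDiff_gaussC κ).mul (hsm l j))) (hpsupp l j)
  have hnormp : ∀ l j x, ‖p l j x‖ = Q j * (‖gaussC κ x‖ * ‖w l j x‖) := fun l j x => by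
    simp [hp, abs_of_pos (hQ0 j)]
  obtain ⟨D, hD⟩ := hdec (n + 1)
  have hgb : ∀ x : R2, ‖x‖ ≤ R → ‖gaussC κ x‖ ≤ Real.exp (κ * R ^ 2) := fun x hx => by
    rw [norm_gaussC]
    gcongr
  obtain ⟨E, hQle⟩ : ∃ E : ℝ, ∀ (j : ℕ) (t : ℝ), 0 ≤ t → ((j : ℝ) + 1) ^ (n + 1) * t ≤ D →
      ((j : ℝ) + 1) * (Q j * t) ≤ E := ⟨(2 * n + 2) ^ n * D, fun j t ht h => by
    calc ((j : ℝ) + 1) * (Q j * t)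
        ≤ ((j : ℝ) + 1) * ((2 * n + 2) ^ n * ((j : ℝ) + 1) ^ n * t) := by
          gcongr
          exact modeWeight_le n j
      _ = (2 * n + 2) ^ n * (((j : ℝ) + 1) ^ (n + 1) * t) := by ring
      _ ≤ _ := by gcongr⟩
  have hn0 : ∀ l, Tendsto (fun j => sqNorm (p l j)) atTop (𝓝 0) := fun l => by
    refine tendsto_sqNorm_zero (R := R) (D := Real.exp (κ * R ^ 2) * E)
      (fun j x hx => hpsupp l j x hx.le) fun j x hx => ?_
    rw [hnormp]
    calc ((j : ℝ) + 1) * (Q j * (‖gaussC κ x‖ * ‖w l j x‖))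
        = ‖gaussC κ x‖ * (((j : ℝ) + 1) * (Q j * ‖w l j x‖)) := by ring
      _ ≤ Real.exp (κ * R ^ 2) * E := by
        have := (hQ0 j).le
        gcongr
        · exact hgb x hx
        · exact hQle j _ (norm_nonneg _) (hD l j x).1
  have hS0 : ∀ l, Tendsto (fun j => sqNorm (wDzAdj κ (p l j))) atTop (𝓝 0) := fun l => by
    refine tendsto_sqNorm_zero (R := R)
      (D := Real.exp (κ * R ^ 2) * (E + 2 * κ * R * E))
      (fun j x hx => ?_) fun j x hx => ?_
    · simp [wDzAdj, dzbar, pdv_eq_zero_of_norm_gt (hpsupp l j) hx, hpsupp l j x hx.le]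
    · have hval := wDzAdj_gaussC_mul (hdiff l j x) κ (Q j : ℂ)
      have hle : ‖dzbar (w l j) x + 2 * κ * zOf x * w l j x‖
          ≤ ‖dzbar (w l j) x‖ + 2 * κ * R * ‖w l j x‖ := by
        refine (norm_add_le _ _).trans ?_
        simp only [norm_mul, norm_zOf, Complex.norm_real, Complex.norm_ofNat,
          Real.norm_of_nonneg hκ0.le]
        gcongr
      have hnorm : ‖wDzAdj κ (p l j) x‖
          = Q j * (‖gaussC κ x‖ * ‖dzbar (w l j) x + 2 * κ * zOf x * w l j x‖) := by
        rw [hp]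
        simp only [hval, norm_mul, Complex.norm_real, Real.norm_of_nonneg (hQ0 j).le]
      rw [hnorm]
      calc ((j : ℝ) + 1) * (Q j * (‖gaussC κ x‖ * ‖dzbar (w l j) x + 2 * κ * zOf x * w l j x‖))
          ≤ ((j : ℝ) + 1) * (Q j * (‖gaussC κ x‖ *
            (‖dzbar (w l j) x‖ + 2 * κ * R * ‖w l j x‖))) := by
            have := (hQ0 j).le
            gcongr
        _ = ‖gaussC κ x‖ * (((j : ℝ) + 1) * (Q j * ‖dzbar (w l j) x‖)
            + 2 * κ * R * (((j : ℝ) + 1) * (Q j * ‖w l j x‖))) := by ring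
        _ ≤ _ := by
            have := (hQ0 j).le
            gcongr
            · exact hgb x hx
            · exact hQle j _ (norm_nonneg _) (hD l j x).2
            · exact hQle j _ (norm_nonneg _) (hD l j x).1
  set nn : ℕ → ℝ := fun j => ∑ l, sqNorm (p l j) with hnn
  have hY : ∀ j, ∑ l, sqNorm (fun x => wDz κ (p l j) x
      + (((j : ℝ) + 2) / (j + 2 + 2 * n) : ℝ) * wDzbar κ (p l (j + 2)) x)
      ≤ C' * (nn j + nn (j + 1) + nn (j + 2)) := by
    intro j
    have hone : ∀ l, sqNorm (fun x => wDz κ (p l j) x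
        + (((j : ℝ) + 2) / (j + 2 + 2 * n) : ℝ) * wDzbar κ (p l (j + 2)) x)
        ≤ C ^ 2 * (3 * c) * (nn j + nn (j + 1) + nn (j + 2)) := by
      intro l
      have hrat := modeWeight_ratio n j
      have hi : ∀ k, Integrable (fun x => ∑ l', normSq (p l' k x)) := fun k =>
        integrable_finsetSum _ fun l' _ => (hpt l' k).integrable_normSq
      have hint : ∀ k, ∫ x, ∑ l', normSq (p l' k x) = nn k := fun k =>
        integral_finsetSum _ fun l' _ => (hpt l' k).integrable_normSq
      have hrhs : C ^ 2 * (3 * c) * (nn j + nn (j + 1) + nn (j + 2))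
          = ∫ x, C ^ 2 * (3 * c) * ((∑ l', normSq (p l' j x)) + (∑ l', normSq (p l' (j + 1) x))
            + ∑ l', normSq (p l' (j + 2) x)) := by
        rw [integral_const_mul, integral_add ((hi j).fun_add (hi (j + 1))) (hi (j + 2)),
          integral_add (hi j) (hi (j + 1)), hint, hint, hint]
      rw [hrhs]
      refine integral_mono
        (((hpt l j).wDz κ).add (((hpt l (j + 2)).wDzbar κ).const_mul _)).integrable_normSq
        ((((hi j).add (hi (j + 1))).add (hi (j + 2))).const_mul _) fun x => ?_
      have hval : wDz κ (p l j) x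
          + (((j : ℝ) + 2) / (j + 2 + 2 * n) : ℝ) * wDzbar κ (p l (j + 2)) x
          = (Q j : ℂ) * (gaussC κ x * (dz (w l j) x + dzbar (w l (j + 2)) x)) := by
        have h1 := wDz_gaussC_mul (hdiff l j x) κ (Q j : ℂ)
        have h2 := wDzbar_gaussC_mul (hdiff l (j + 2) x) κ (Q (j + 2) : ℂ)
        have h3 : (Q j : ℂ)
            = (((j : ℝ) + 2) / (j + 2 + 2 * n) : ℝ) * (Q (j + 2) : ℂ) := by
          rw [hQ, hrat]
          push_cast
          ring
        simp only [hp]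
        rw [h1, h2]
        linear_combination (-(gaussC κ x * dzbar (w l (j + 2)) x)) * h3
      simp only [hval, normSq_eq_norm_sq]
      have hQ1 : Q j ≤ Q (j + 1) := modeWeight_mono n (by omega)
      have hQ2 : Q j ≤ Q (j + 2) := modeWeight_mono n (by omega)
      have hle : ‖(Q j : ℂ) * (gaussC κ x * (dz (w l j) x + dzbar (w l (j + 2)) x))‖
          ≤ C * ∑ l', (‖p l' j x‖ + ‖p l' (j + 1) x‖ + ‖p l' (j + 2) x‖) := by
        rw [norm_mul, norm_mul, Complex.norm_real, Real.norm_of_nonneg (hQ0 j).le]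
        calc Q j * (‖gaussC κ x‖ * ‖dz (w l j) x + dzbar (w l (j + 2)) x‖)
            ≤ Q j * (‖gaussC κ x‖ *
              (C * ∑ l', (‖w l' j x‖ + ‖w l' (j + 1) x‖ + ‖w l' (j + 2) x‖))) := by
              have := (hQ0 j).le
              gcongr
              exact hsys l j x
          _ = C * ∑ l', (Q j * (‖gaussC κ x‖ * ‖w l' j x‖)
              + Q j * (‖gaussC κ x‖ * ‖w l' (j + 1) x‖)
              + Q j * (‖gaussC κ x‖ * ‖w l' (j + 2) x‖)) := by
              rw [mul_left_comm _ C, mul_left_comm _ C, Finset.mul_sum, Finset.mul_sum]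
              congr 1
              refine Finset.sum_congr rfl fun l' _ => ?_
              ring
          _ ≤ _ := by
              simp only [hnormp]
              gcongr
      calc ‖(Q j : ℂ) * (gaussC κ x * (dz (w l j) x + dzbar (w l (j + 2)) x))‖ ^ 2
          ≤ (C * ∑ l', (‖p l' j x‖ + ‖p l' (j + 1) x‖ + ‖p l' (j + 2) x‖)) ^ 2 := by gcongr
        _ = C ^ 2 * (∑ l', (‖p l' j x‖ + ‖p l' (j + 1) x‖ + ‖p l' (j + 2) x‖)) ^ 2 := by ring
        _ ≤ C ^ 2 * (3 * c * ∑ l', (‖p l' j x‖ ^ 2 + ‖p l' (j + 1) x‖ ^ 2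
            + ‖p l' (j + 2) x‖ ^ 2)) := by
            gcongr
            exact sq_sum_three_le _ _ _
        _ = _ := by
            rw [Finset.sum_add_distrib, Finset.sum_add_distrib]
            ring
    calc _ ≤ ∑ _l : ι, C ^ 2 * (3 * c) * (nn j + nn (j + 1) + nn (j + 2)) :=
          Finset.sum_le_sum fun l _ => hone l
      _ = _ := by
          rw [Finset.sum_const, Finset.card_univ, nsmul_eq_mul]
          ring
  have hzero := modes_eq_zero (n := nn) (S := fun j => ∑ l, sqNorm (wDzAdj κ (p l j)))
    (T := fun j => ∑ l, sqNorm (wDzbarAdj κ (p l j)))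
    (N := 2 * n) (κ := κ) (R := R) (θ := θ) (C := C') hC'0 (by linarith) hN hθ0
    (min_le_left _ _) hθ2 (fun j => Finset.sum_nonneg fun l _ => sqNorm_nonneg _)
    (fun j => Finset.sum_nonneg fun l _ => sqNorm_nonneg _)
    (fun j => Finset.sum_nonneg fun l _ => sqNorm_nonneg _)
    (fun j ε hε => by
      have := Finset.sum_le_sum fun l (_ : l ∈ Finset.univ) =>
        sqNorm_wDzbarAdj_le (hpt l j) hκ0.le hε (hpsupp l j)
      simpa only [Finset.sum_add_distrib, ← Finset.mul_sum] using this)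
    (fun j => by
      have hd : (2 * n : ℝ) / (j + 2 + 2 * n) = 1 - ((j : ℝ) + 2) / (j + 2 + 2 * n) := by
        have : (0 : ℝ) < j + 2 + 2 * n := by positivity
        field_simp
        ring
      have hr1 : ((j : ℝ) + 2) / (j + 2 + 2 * n) ≤ 1 := by
        rw [div_le_one (by positivity)]
        linarith [Nat.cast_nonneg (α := ℝ) n]
      have := Finset.sum_le_sum fun l (_ : l ∈ Finset.univ) =>
        sqNorm_pair_ge (hpt l j) (hpt l (j + 2)) (r := ((j : ℝ) + 2) / (j + 2 + 2 * n))
          hκ0.le (by positivity) hθ0.le ((min_le_left _ _).trans (by norm_num))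
      simp only [Finset.sum_add_distrib, Finset.sum_sub_distrib, ← Finset.mul_sum] at this
      rw [hd]
      exact this)
    hY (by simpa using tendsto_finsetSum Finset.univ fun l _ => hn0 l)
    (by simpa using tendsto_finsetSum Finset.univ fun l _ => hS0 l) j
  have h1 : sqNorm (p l j) = 0 :=
    (Finset.sum_eq_zero_iff_of_nonneg fun l _ => sqNorm_nonneg _).1 hzero l (Finset.mem_univ l)
  have h2 := eq_zero_of_sqNorm_eq_zero (hpt l j) h1 x
  have h3 := hnormp l j x
  rw [h2, norm_zero, norm_gaussC] at h3
  have h4 : 0 < Q j * Real.exp (κ * ‖x‖ ^ 2) := mul_pos (hQ0 j) (Real.exp_pos _)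
  rw [← mul_assoc] at h3
  exact norm_eq_zero.1 ((mul_eq_zero.1 h3.symm).resolve_left h4.ne')

/-! ### Smooth dependence on parameters -/

/-- evaluation at a vector, as a map between spaces of continuous functions -/
def evalCLM (K Q E : Type) [TopologicalSpace K] [CompactSpace K] [NormedAddCommGroup Q]
    [NormedSpace ℝ Q] [NormedAddCommGroup E] [NormedSpace ℝ E] :
    C(K, Q →L[ℝ] E) →L[ℝ] Q →L[ℝ] C(K, E) :=
  LinearMap.mkContinuous₂
    (LinearMap.mk₂ ℝ (fun (g : C(K, Q →L[ℝ] E)) (v : Q) =>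
        (⟨fun τ => g τ v, by fun_prop⟩ : C(K, E)))
      (fun _ _ _ => by ext; simp) (fun _ _ _ => by ext; simp)
      (fun _ _ _ => by ext; simp) (fun _ _ _ => by ext; simp)) 1
    (fun g v => by
      rw [one_mul]
      refine (ContinuousMap.norm_le _ (by positivity)).2 fun τ => ?_
      exact (g τ).le_of_opNorm_le (g.norm_coe_le_norm τ) v)

@[simp] lemma evalCLM_apply {K Q E : Type} [TopologicalSpace K] [CompactSpace K]
    [NormedAddCommGroup Q] [NormedSpace ℝ Q] [NormedAddCommGroup E] [NormedSpace ℝ E]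
    (g : C(K, Q →L[ℝ] E)) (v : Q) (τ : K) : evalCLM K Q E g v τ = g τ v := rfl

section Slices

variable {Q E : Type} [NormedAddCommGroup Q] [NormedSpace ℝ Q] [NormedAddCommGroup E]
  [NormedSpace ℝ E]

/-- the slice `τ ↦ f (τ, q)` on the unit interval -/
def slice (f : ℝ × Q → E) (hf : Continuous f) (q : Q) : C(unitInterval, E) :=
  ⟨fun τ => f (τ, q), by fun_prop⟩

@[simp] lemma slice_apply (f : ℝ × Q → E) (hf : Continuous f) (q : Q) (τ : unitInterval) :
    slice f hf q τ = f (τ, q) := rfl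

lemma continuous_slice (f : ℝ × Q → E) (hf : Continuous f) : Continuous (slice f hf) :=
  (ContinuousMap.curry ⟨fun p : Q × unitInterval => f (p.2, p.1), by fun_prop⟩).continuous

/-- the derivative in the parameter -/
def paramDeriv (f : ℝ × Q → E) (p : ℝ × Q) : Q →L[ℝ] E :=
  (fderiv ℝ f p).comp (ContinuousLinearMap.inr ℝ ℝ Q)

lemma contDiff_paramDeriv {f : ℝ × Q → E} (hf : ContDiff ℝ (⊤ : ℕ∞) f) :
    ContDiff ℝ (⊤ : ℕ∞) (paramDeriv f) :=
  (hf.fderiv_right (m := (⊤ : ℕ∞)) (by simp)).clm_comp contDiff_const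

lemma hasFDerivAt_paramDeriv {f : ℝ × Q → E} (hf : ContDiff ℝ (⊤ : ℕ∞) f) (τ : ℝ) (q : Q) :
    HasFDerivAt (fun q => f (τ, q)) (paramDeriv f (τ, q)) q :=
  ((hf.differentiable (by simp)) (τ, q)).hasFDerivAt.comp q (hasFDerivAt_prodMk_right τ q)

lemma hasFDerivAt_slice {f : ℝ × Q → E} (hf : ContDiff ℝ (⊤ : ℕ∞) f) (q : Q) :
    HasFDerivAt (slice f hf.continuous)
      (evalCLM unitInterval Q E (slice (paramDeriv f) (contDiff_paramDeriv hf).continuous q)) q := by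
  rw [hasFDerivAt_iff_isLittleO, Asymptotics.isLittleO_iff]
  intro ε hε
  have hc := (continuous_slice (paramDeriv f) (contDiff_paramDeriv hf).continuous).continuousAt
    (x := q)
  obtain ⟨δ, hδ, hball⟩ := Metric.continuousAt_iff.1 hc ε hε
  filter_upwards [Metric.ball_mem_nhds q hδ] with q' hq'
  refine (ContinuousMap.norm_le _ (by positivity)).2 fun τ => ?_
  refine (convex_ball q δ).norm_image_sub_le_of_norm_hasFDerivWithin_le'
    (f := fun q => f (τ, q)) (f' := fun q => paramDeriv f (τ, q))
    (fun x _ => (hasFDerivAt_paramDeriv hf τ x).hasFDerivWithinAt) (fun x hx => ?_)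
    (Metric.mem_ball_self hδ) hq'
  have h1 := (hball (Metric.mem_ball.1 hx)).le
  rw [dist_eq_norm] at h1
  exact ((slice (paramDeriv f) (contDiff_paramDeriv hf).continuous x
    - slice (paramDeriv f) (contDiff_paramDeriv hf).continuous q).norm_coe_le_norm τ).trans h1

end Slices

lemma contDiff_slice_nat {Q : Type} [NormedAddCommGroup Q] [NormedSpace ℝ Q] (n : ℕ) :
    ∀ {E : Type} [NormedAddCommGroup E] [NormedSpace ℝ E] {f : ℝ × Q → E}
      (hf : ContDiff ℝ (⊤ : ℕ∞) f), ContDiff ℝ n (slice f hf.continuous) := by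
  induction n with
  | zero =>
    intro E _ _ f hf
    exact contDiff_zero.2 (continuous_slice f hf.continuous)
  | succ n ih =>
    intro E _ _ f hf
    refine contDiff_succ_iff_hasFDerivAt.2 ⟨_, ?_, hasFDerivAt_slice hf⟩
    exact (ContinuousLinearMap.contDiff (E := C(unitInterval, Q →L[ℝ] E))
      (F := Q →L[ℝ] C(unitInterval, E)) (evalCLM unitInterval Q E)).comp
      (ih (contDiff_paramDeriv hf))

/-- Slices depend smoothly on the parameter. -/
lemma contDiff_slice {Q E : Type} [NormedAddCommGroup Q] [NormedSpace ℝ Q]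
    [NormedAddCommGroup E] [NormedSpace ℝ E] {f : ℝ × Q → E} (hf : ContDiff ℝ (⊤ : ℕ∞) f) :
    ContDiff ℝ (⊤ : ℕ∞) (slice f hf.continuous) :=
  contDiff_infty.2 fun n => contDiff_slice_nat n hf

lemma continuous_extend {E : Type} [TopologicalSpace E] (g : C(unitInterval, E)) :
    Continuous (fun s : ℝ => g (Set.projIcc 0 1 zero_le_one s)) :=
  g.continuous.comp continuous_projIcc

section Primitive

variable {E : Type} [NormedAddCommGroup E] [NormedSpace ℝ E]

/-- the primitive vanishing at the left endpoint -/
def primitiveCLM (E : Type) [NormedAddCommGroup E] [NormedSpace ℝ E] :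
    C(unitInterval, E) →L[ℝ] C(unitInterval, E) :=
  LinearMap.mkContinuous
    { toFun := fun g => ⟨fun τ => ∫ s in (0 : ℝ)..τ, g (Set.projIcc 0 1 zero_le_one s),
        (intervalIntegral.continuous_primitive
          (fun a b => (continuous_extend g).intervalIntegrable a b) 0).comp
            continuous_subtype_val⟩
      map_add' := fun g h => by
        ext τ
        simp only [ContinuousMap.add_apply, ContinuousMap.coe_mk]
        exact intervalIntegral.integral_add ((continuous_extend g).intervalIntegrable _ _)
          ((continuous_extend h).intervalIntegrable _ _)
      map_smul' := fun c g => by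
        ext τ
        simp } 1
    (fun g => by
      rw [one_mul]
      refine (ContinuousMap.norm_le _ (norm_nonneg _)).2 fun τ => ?_
      refine (intervalIntegral.norm_integral_le_of_norm_le_const
        (C := ‖g‖) fun s _ => g.norm_coe_le_norm _).trans ?_
      rw [sub_zero, abs_of_nonneg τ.2.1]
      exact mul_le_of_le_one_right (norm_nonneg _) τ.2.2)

end Primitive

/-- Parametric integrals of smooth functions are smooth. -/
lemma contDiff_integral_param {Q E : Type} [NormedAddCommGroup Q] [NormedSpace ℝ Q]
    [NormedAddCommGroup E] [NormedSpace ℝ E] {f : ℝ × Q → E} (hf : ContDiff ℝ (⊤ : ℕ∞) f) :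
    ContDiff ℝ (⊤ : ℕ∞) (fun q => ∫ s in (0 : ℝ)..1, f (s, q)) ∧
    ∀ q v, fderiv ℝ (fun q => ∫ s in (0 : ℝ)..1, f (s, q)) q v
      = ∫ s in (0 : ℝ)..1, fderiv ℝ (fun q => f (s, q)) q v := by
  set I : C(unitInterval, E) →L[ℝ] E :=
    (ContinuousMap.evalCLM ℝ (1 : unitInterval)).comp (primitiveCLM E) with hI
  have hIg : ∀ g : C(unitInterval, E),
      I g = ∫ s in (0 : ℝ)..1, g (Set.projIcc 0 1 zero_le_one s) := fun g => rfl
  have hext : ∀ {F : Type} (h : ℝ → F) (s : ℝ), s ∈ Set.uIcc (0 : ℝ) 1 →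
      h (Set.projIcc (0 : ℝ) 1 zero_le_one s) = h s := by
    intro F h s hs
    rw [Set.uIcc_of_le zero_le_one] at hs
    rw [Set.projIcc_of_mem _ hs]
  have heq : (fun q => ∫ s in (0 : ℝ)..1, f (s, q)) = fun q => I (slice f hf.continuous q) := by
    ext q
    rw [hIg]
    refine intervalIntegral.integral_congr fun s hs => ?_
    exact (hext (fun s => f (s, q)) s hs).symm
  refine ⟨?_, fun q v => ?_⟩
  · rw [heq]
    exact I.contDiff.comp (contDiff_slice hf)
  · have h := (I.hasFDerivAt.comp q (hasFDerivAt_slice hf q)).fderiv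
    have h2 : fderiv ℝ (fun q => I (slice f hf.continuous q)) q = _ := h
    rw [heq, h2]
    simp only [ContinuousLinearMap.comp_apply, hIg, evalCLM_apply, slice_apply]
    refine intervalIntegral.integral_congr fun s hs => ?_
    simp only [(hasFDerivAt_paramDeriv hf s q).fderiv]
    exact hext (fun s => paramDeriv f (s, q) v) s hs

/-! ### Linear differential equations with parameters -/

lemma isUnit_one_sub_of_norm_conj_lt_one {X : Type} [NormedAddCommGroup X] [NormedSpace ℝ X]
    [CompleteSpace X] {T a b : X →L[ℝ] X} (hab : a * b = 1) (hba : b * a = 1)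
    (h : ‖a * T * b‖ < 1) : IsUnit (1 - T) := by
  have hu : IsUnit (1 - a * T * b) := isUnit_one_sub_of_norm_lt_one h
  have hconj : 1 - T = b * (1 - a * T * b) * a := by
    have : b * (1 - a * T * b) * a = b * a - (b * a) * T * (b * a) := by noncomm_ring
    rw [this, hba, one_mul, mul_one]
  rw [hconj]
  have ha : IsUnit a := ⟨⟨a, b, hab, hba⟩, rfl⟩
  have hb : IsUnit b := ⟨⟨b, a, hba, hab⟩, rfl⟩
  exact (hb.mul hu).mul ha

lemma contDiff_ringInverse_apply {X Y : Type} [NormedAddCommGroup X] [NormedSpace ℝ X]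
    [CompleteSpace X] [NormedAddCommGroup Y] [NormedSpace ℝ Y] (T : Y →L[ℝ] X →L[ℝ] X)
    (hT : ∀ y, IsUnit (1 - T y)) (x : X) :
    ContDiff ℝ (⊤ : ℕ∞) fun y => Ring.inverse (1 - T y) x := by
  have h1 : ContDiff ℝ (⊤ : ℕ∞) (fun y => 1 - T y) := contDiff_const.sub T.contDiff
  have h2 : ContDiff ℝ (⊤ : ℕ∞) (fun y => Ring.inverse (1 - T y)) := by
    rw [contDiff_iff_contDiffAt]
    intro y
    obtain ⟨u, hu⟩ := hT y
    have := contDiffAt_ringInverse (R := X →L[ℝ] X) (n := (⊤ : ℕ∞)) ℝ u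
    rw [hu] at this
    exact this.comp y h1.contDiffAt
  exact h2.clm_apply contDiff_const

section LinearODE

variable {E : Type} [NormedRing E] [NormedAlgebra ℝ E] [CompleteSpace E]

/-- the Volterra operator `g ↦ ∫₀ L g` -/
def volterra (L : C(unitInterval, E)) : C(unitInterval, E) →L[ℝ] C(unitInterval, E) :=
  (primitiveCLM E).comp (ContinuousLinearMap.mul ℝ C(unitInterval, E) L)

lemma volterra_apply (L g : C(unitInterval, E)) (τ : unitInterval) :
    volterra L g τ = ∫ s in (0 : ℝ)..τ, L (Set.projIcc 0 1 zero_le_one s) *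
      g (Set.projIcc 0 1 zero_le_one s) := rfl

/-- the function `e^{c τ}` -/
def expFun (E : Type) [NormedRing E] [NormedAlgebra ℝ E] (c : ℝ) : C(unitInterval, E) :=
  ⟨fun τ => algebraMap ℝ E (Real.exp (c * τ)), by
    refine (continuous_algebraMap ℝ E).comp ?_
    fun_prop⟩

lemma expFun_mul (c d : ℝ) : expFun E c * expFun E d = expFun E (c + d) := by
  ext τ
  simp only [expFun, ContinuousMap.mul_apply, ContinuousMap.coe_mk, ← map_mul, ← Real.exp_add]
  ring_nf

lemma expFun_zero : expFun E 0 = 1 := by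
  ext τ
  simp [expFun]

lemma isUnit_one_sub_volterra (L : C(unitInterval, E)) : IsUnit (1 - volterra L) := by
  set lam : ℝ := ‖L‖ + 1 with hlam
  have hlam0 : 0 < lam := by positivity
  let m := ContinuousLinearMap.mul ℝ C(unitInterval, E)
  have hm : ∀ c d : ℝ, m (expFun E c) * m (expFun E d) = m (expFun E (c + d)) := by
    intro c d
    ext1 g
    change expFun E c * (expFun E d * g) = expFun E (c + d) * g
    rw [← mul_assoc, expFun_mul]
  have hm0 : m (expFun E 0) = 1 := by
    ext1 g
    change expFun E 0 * g = g
    rw [expFun_zero, one_mul]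
  have hB : ‖m (expFun E (-lam)) * volterra L * m (expFun E lam)‖ < 1 := by
    have hle : ‖m (expFun E (-lam)) * volterra L * m (expFun E lam)‖ ≤ ‖L‖ / lam := by
      refine ContinuousLinearMap.opNorm_le_bound _ (by positivity) fun g => ?_
      refine (ContinuousMap.norm_le _ (by positivity)).2 fun τ => ?_
      change ‖algebraMap ℝ E (Real.exp (-lam * τ)) * volterra L (expFun E lam * g) τ‖ ≤ _
      rw [volterra_apply, ← Algebra.smul_def, norm_smul, Real.norm_of_nonneg (Real.exp_pos _).le]
      have hint : ‖∫ s in (0 : ℝ)..τ, L (Set.projIcc 0 1 zero_le_one s) *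
          (expFun E lam * g) (Set.projIcc 0 1 zero_le_one s)‖
          ≤ ∫ s in (0 : ℝ)..τ, ‖L‖ * ‖g‖ * Real.exp (lam * s) := by
        refine intervalIntegral.norm_integral_le_of_norm_le τ.2.1 ?_
          (Continuous.intervalIntegrable (by fun_prop) _ _)
        refine Filter.Eventually.of_forall fun s hs => ?_
        have hs' : s ∈ Set.Icc (0 : ℝ) 1 := ⟨hs.1.le, hs.2.trans τ.2.2⟩
        rw [Set.projIcc_of_mem _ hs']
        change ‖L ⟨s, hs'⟩ * (algebraMap ℝ E (Real.exp (lam * s)) * g ⟨s, hs'⟩)‖ ≤ _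
        rw [← Algebra.smul_def, mul_smul_comm, norm_smul, Real.norm_of_nonneg (Real.exp_pos _).le,
          mul_comm]
        gcongr
        refine (norm_mul_le _ _).trans ?_
        gcongr
        · exact L.norm_coe_le_norm _
        · exact g.norm_coe_le_norm _
      have hval : ∫ s in (0 : ℝ)..τ, ‖L‖ * ‖g‖ * Real.exp (lam * s)
          = ‖L‖ * ‖g‖ * ((Real.exp (lam * τ) - 1) / lam) := by
        rw [intervalIntegral.integral_const_mul, intervalIntegral.integral_comp_mul_left
          (fun x => Real.exp x) hlam0.ne', integral_exp]
        simp
        left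
        ring
      rw [hval] at hint
      calc Real.exp (-lam * τ) * _
          ≤ Real.exp (-lam * τ) * (‖L‖ * ‖g‖ * ((Real.exp (lam * τ) - 1) / lam)) := by gcongr
        _ = ‖L‖ / lam * ‖g‖ * (Real.exp (-lam * τ) * Real.exp (lam * τ)
            - Real.exp (-lam * τ)) := by ring
        _ ≤ ‖L‖ / lam * ‖g‖ * 1 := by
            rw [← Real.exp_add]
            have := Real.exp_pos (-lam * τ)
            gcongr
            simp only [neg_mul, neg_add_cancel, Real.exp_zero]
            linarith [Real.exp_pos (-(lam * τ))]
        _ = _ := mul_one _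
    refine hle.trans_lt ?_
    rw [div_lt_one hlam0]
    linarith
  exact isUnit_one_sub_of_norm_conj_lt_one (by rw [hm, neg_add_cancel, hm0])
    (by rw [hm, add_neg_cancel, hm0]) hB

/-- the solution of `W = 1 + ∫₀ L W` -/
def volterraSol (L : C(unitInterval, E)) : C(unitInterval, E) :=
  Ring.inverse (1 - volterra L) 1

lemma volterraSol_eq (L : C(unitInterval, E)) :
    volterraSol L = 1 + volterra L (volterraSol L) := by
  have h := Ring.mul_inverse_cancel _ (isUnit_one_sub_volterra L)
  have h2 := congrArg (fun T : C(unitInterval, E) →L[ℝ] C(unitInterval, E) => T 1) h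
  change volterraSol L - volterra L (volterraSol L) = 1 at h2
  rw [← h2, sub_add_cancel]

lemma eq_volterraSol {L V : C(unitInterval, E)} (h : V = 1 + volterra L V) :
    V = volterraSol L := by
  have h1 := Ring.inverse_mul_cancel _ (isUnit_one_sub_volterra L)
  have h2 := congrArg (fun T : C(unitInterval, E) →L[ℝ] C(unitInterval, E) => T V) h1
  change Ring.inverse (1 - volterra L) (V - volterra L V) = V at h2
  rw [← h2, volterraSol]
  congr 1
  exact sub_eq_of_eq_add h

lemma contDiff_volterraSol : ContDiff ℝ (⊤ : ℕ∞) (volterraSol (E := E)) :=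
  contDiff_ringInverse_apply
    ((ContinuousLinearMap.compL ℝ C(unitInterval, E) C(unitInterval, E) C(unitInterval, E)
      (primitiveCLM E)).comp (ContinuousLinearMap.mul ℝ C(unitInterval, E)))
    isUnit_one_sub_volterra 1

/-- Linear equations `U' = M U` with smooth coefficients have solutions depending smoothly on
time and parameters. -/
theorem exists_smooth_linear_flow {Q : Type} [NormedAddCommGroup Q] [NormedSpace ℝ Q]
    {M : ℝ × Q → E} (hM : ContDiff ℝ (⊤ : ℕ∞) M) :
    ∃ U : ℝ × Q → E, ContDiff ℝ (⊤ : ℕ∞) U ∧ (∀ q, U (0, q) = 1) ∧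
      ∀ t q, HasDerivAt (fun t => U (t, q)) (M (t, q) * U (t, q)) t := by
  set f : ℝ × (ℝ × Q) → E := fun p => p.2.1 • M (p.1 * p.2.1, p.2.2) with hf
  have hfs : ContDiff ℝ (⊤ : ℕ∞) f :=
    contDiff_snd.fst.smul (hM.comp ((contDiff_fst.mul contDiff_snd.fst).prodMk contDiff_snd.snd))
  set W : ℝ × Q → C(unitInterval, E) := fun p => volterraSol (slice f hfs.continuous p) with hW
  have hWs : ContDiff ℝ (⊤ : ℕ∞) W := contDiff_volterraSol.comp (contDiff_slice hfs)
  set U : ℝ × Q → E := fun p => W p 1 with hU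
  have hUs : ContDiff ℝ (⊤ : ℕ∞) U :=
    (ContinuousLinearMap.contDiff (E := C(unitInterval, E)) (F := E)
      (ContinuousMap.evalCLM ℝ (1 : unitInterval))).comp hWs
  have hWint : ∀ (t : ℝ) (q : Q) (τ : unitInterval), W (t, q) τ
      = 1 + ∫ s in (0 : ℝ)..τ, (t • M (s * t, q)) * W (t, q) (Set.projIcc 0 1 zero_le_one s) := by
    intro t q τ
    have h := congrArg (fun g : C(unitInterval, E) => g τ)
      (volterraSol_eq (slice f hfs.continuous (t, q)))
    refine h.trans ?_
    simp only [ContinuousMap.add_apply, ContinuousMap.one_apply, volterra_apply]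
    congr 1
    refine intervalIntegral.integral_congr fun s hs => ?_
    rw [Set.uIcc_of_le τ.2.1] at hs
    simp only [slice_apply, Set.projIcc_of_mem zero_le_one
      (⟨hs.1, hs.2.trans τ.2.2⟩ : s ∈ Set.Icc (0 : ℝ) 1), hf, hW]
  have hscale : ∀ (t : ℝ) (q : Q) (τ : unitInterval), W (t, q) τ = U (t * τ, q) := by
    intro t q τ
    let V : C(unitInterval, E) := ⟨fun σ => W (t, q) (σ * τ), by fun_prop⟩
    have hV : V = W (t * τ, q) := by
      refine eq_volterraSol ?_
      ext σ
      change W (t, q) (σ * τ) = 1 + volterra _ _ _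
      rw [hWint, volterra_apply]
      congr 1
      have hsub := intervalIntegral.smul_integral_comp_mul_right (a := 0) (b := (σ : ℝ))
        (fun s => (t • M (s * t, q)) * W (t, q) (Set.projIcc 0 1 zero_le_one s)) (τ : ℝ)
      rw [zero_mul] at hsub
      change ∫ s in (0 : ℝ)..(σ * τ : ℝ), _ = _
      rw [← hsub, ← intervalIntegral.integral_smul]
      refine intervalIntegral.integral_congr fun s hs => ?_
      rw [Set.uIcc_of_le σ.2.1] at hs
      have hs1 : s ∈ Set.Icc (0 : ℝ) 1 := ⟨hs.1, hs.2.trans σ.2.2⟩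
      have hs2 : s * τ ∈ Set.Icc (0 : ℝ) 1 :=
        ⟨mul_nonneg hs1.1 τ.2.1, mul_le_one₀ hs1.2 τ.2.1 τ.2.2⟩
      simp only [Set.projIcc_of_mem zero_le_one hs1, Set.projIcc_of_mem zero_le_one hs2,
        slice_apply, hf]
      change _ = _ * W (t, q) (⟨s, hs1⟩ * τ)
      rw [← smul_mul_assoc, smul_smul]
      have e1 : s * τ * t = s * (t * τ) := by ring
      rw [mul_comm (τ : ℝ) t, e1]
      rfl
    have := congrArg (fun g : C(unitInterval, E) => g 1) hV
    change W (t, q) (1 * τ) = U (t * τ, q) at this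
    rwa [one_mul] at this
  have hUint : ∀ (t : ℝ) (q : Q), U (t, q) = 1 + ∫ s in (0 : ℝ)..t, M (s, q) * U (s, q) := by
    intro t q
    have hsub := intervalIntegral.smul_integral_comp_mul_right (a := 0) (b := 1)
      (fun s => M (s, q) * U (s, q)) t
    rw [zero_mul, one_mul] at hsub
    have h1 := hWint t q 1
    change U (t, q) = _ at h1
    rw [h1, ← hsub, ← intervalIntegral.integral_smul]
    congr 1
    refine intervalIntegral.integral_congr fun s hs => ?_
    change s ∈ Set.uIcc (0 : ℝ) 1 at hs
    rw [Set.uIcc_of_le zero_le_one] at hs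
    simp only [Set.projIcc_of_mem zero_le_one hs, hscale]
    rw [smul_mul_assoc, mul_comm t s]
  refine ⟨U, hUs, fun q => by rw [hUint]; simp, fun t q => ?_⟩
  have hcont : Continuous fun s : ℝ => M (s, q) * U (s, q) := by
    have := hM.continuous
    have := hUs.continuous
    fun_prop
  have hd := (intervalIntegral.integral_hasDerivAt_right (hcont.intervalIntegrable 0 t)
    (hcont.stronglyMeasurableAtFilter _ _) hcont.continuousAt).const_add (1 : E)
  exact hd.congr_of_eventuallyEq (Filter.Eventually.of_forall fun s => hUint s q)

end LinearODE

/-! ### The transport equation -/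

lemma eq_of_hasDerivAt_zero {E : Type} [NormedAddCommGroup E] [NormedSpace ℝ E] {f : ℝ → E}
    {a b : ℝ} (hab : a ≤ b) (h : ∀ s ∈ Set.Icc a b, HasDerivAt f 0 s) : f a = f b := by
  refine (constant_of_has_deriv_right_zero (fun s hs => (h s hs).continuousAt.continuousWithinAt)
    (fun s hs => (h s ⟨hs.1, hs.2.le⟩).hasDerivWithinAt) b ⟨hab, le_rfl⟩).symm

lemma norm_sq_add_smul {θ : R2} (hθ : ‖θ‖ = 1) (x : R2) (s : ℝ) :
    ‖x + s • θ‖ ^ 2 = ‖x‖ ^ 2 + 2 * s * inner ℝ x θ + s ^ 2 := by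
  rw [norm_add_sq_real, inner_smul_right, norm_smul, hθ, mul_one, Real.norm_eq_abs, sq_abs]
  ring

lemma inner_add_smul {θ : R2} (hθ : ‖θ‖ = 1) (x : R2) (s : ℝ) :
    inner ℝ (x + s • θ) θ = inner ℝ x θ + s := by
  rw [inner_add_left, inner_smul_left, real_inner_self_eq_norm_sq, hθ]
  simp

lemma le_norm_add_smul {θ : R2} (hθ : ‖θ‖ = 1) {x : R2} {R s : ℝ} (hR : R ≤ ‖x‖)
    (hs : 0 ≤ s * inner ℝ x θ) : R ≤ ‖x + s • θ‖ := by
  refine hR.trans ((pow_le_pow_iff_left₀ (norm_nonneg _) (norm_nonneg _) two_ne_zero).1 ?_)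
  rw [norm_sq_add_smul hθ]
  nlinarith [sq_nonneg s]

lemma le_norm_of_inner_le {θ : R2} (hθ : ‖θ‖ = 1) {x : R2} {R : ℝ} (h : inner ℝ x θ ≤ -R) :
    R ≤ ‖x‖ := by
  have := abs_real_inner_le_norm x θ
  rw [hθ, mul_one] at this
  linarith [neg_abs_le (inner ℝ x θ)]

section TransportSolution

variable {E : Type} [NormedRing E] [NormedAlgebra ℝ E] [CompleteSpace E]

theorem exists_transport_solution {A : R2 × R2 → E} (hA : ContDiff ℝ (⊤ : ℕ∞) A) {R : ℝ}
    (hsupp : ∀ x θ, R ≤ ‖x‖ → A (x, θ) = 0) :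
    ∃ c : R2 × R2 → E, ContDiff ℝ (⊤ : ℕ∞) c ∧ ∀ θ, ‖θ‖ = 1 →
      (∀ (x : R2) (s : ℝ), HasDerivAt (fun s : ℝ => c (x + s • θ, θ))
        (A (x + s • θ, θ) * c (x + s • θ, θ)) s) ∧
      (∀ x, R ≤ ‖x‖ → inner ℝ x θ ≤ 0 → c (x, θ) = 1) ∧
      (∀ (x : R2) (s : ℝ), R ≤ ‖x‖ → 0 ≤ inner ℝ x θ → 0 ≤ s → c (x + s • θ, θ) = c (x, θ)) := by
  have hM : ContDiff ℝ (⊤ : ℕ∞) (fun p : ℝ × (R2 × R2) => A (p.2.1 + p.1 • p.2.2, p.2.2)) :=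
    hA.comp (by fun_prop)
  obtain ⟨U, hUs, hU0, hU⟩ := exists_smooth_linear_flow hM
  set c : R2 × R2 → E := fun p =>
    U (inner ℝ p.1 p.2 + R, (p.1 - (inner ℝ p.1 p.2 + R) • p.2, p.2)) with hc
  have hcU : ∀ θ : R2, ‖θ‖ = 1 → ∀ (x : R2) (s : ℝ), c (x + s • θ, θ)
      = U (s + (inner ℝ x θ + R), (x - (inner ℝ x θ + R) • θ, θ)) := by
    intro θ hθ x s
    simp only [hc, inner_add_smul hθ]
    congr 2
    · ring
    · congr 1
      module
  have hder : ∀ θ : R2, ‖θ‖ = 1 → ∀ (x : R2) (s : ℝ), HasDerivAt (fun s : ℝ => c (x + s • θ, θ))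
      (A (x + s • θ, θ) * c (x + s • θ, θ)) s := by
    intro θ hθ x s
    simp only [hcU θ hθ x]
    have h := (hU (s + (inner ℝ x θ + R)) (x - (inner ℝ x θ + R) • θ, θ)).comp_add_const s
      (inner ℝ x θ + R)
    have hxs : x + s • θ
        = x - (inner ℝ x θ + R) • θ + (s + (inner ℝ x θ + R)) • θ := by module
    rw [hxs]
    exact h
  have hder0 : ∀ θ : R2, ‖θ‖ = 1 → ∀ (x : R2) (s : ℝ), R ≤ ‖x + s • θ‖ →
      HasDerivAt (fun s : ℝ => c (x + s • θ, θ)) 0 s := by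
    intro θ hθ x s hs
    have h := hder θ hθ x s
    rwa [hsupp _ _ hs, zero_mul] at h
  have hin : ContDiff ℝ (⊤ : ℕ∞) fun p : R2 × R2 => inner ℝ p.1 p.2 + R :=
    (contDiff_fst.inner ℝ contDiff_snd).add contDiff_const
  refine ⟨c, hUs.comp (hin.prodMk ((contDiff_fst.sub (hin.smul contDiff_snd)).prodMk
    contDiff_snd)), fun θ hθ => ⟨hder θ hθ, fun x hx hxθ => ?_,
    fun x s hx hxθ hs => ?_⟩⟩
  · have hstart : c (x + (-(inner ℝ x θ + R)) • θ, θ) = 1 := by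
      rw [hcU θ hθ, neg_add_cancel, hU0]
    have hx0 : c (x, θ) = c (x + (0 : ℝ) • θ, θ) := by rw [zero_smul, add_zero]
    rw [hx0, ← hstart]
    rcases le_total 0 (inner ℝ x θ + R) with h | h
    · refine (eq_of_hasDerivAt_zero (f := fun s : ℝ => c (x + s • θ, θ)) (by linarith)
        fun s hs => hder0 θ hθ x s ?_).symm
      exact le_norm_add_smul hθ hx (mul_nonneg_of_nonpos_of_nonpos hs.2 hxθ)
    · refine eq_of_hasDerivAt_zero (f := fun s : ℝ => c (x + s • θ, θ)) (by linarith)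
        fun s hs => hder0 θ hθ x s ?_
      refine le_norm_of_inner_le hθ ?_
      rw [inner_add_smul hθ]
      linarith [hs.2]
  · have hx0 : c (x, θ) = c (x + (0 : ℝ) • θ, θ) := by rw [zero_smul, add_zero]
    rw [hx0]
    refine (eq_of_hasDerivAt_zero (f := fun s : ℝ => c (x + s • θ, θ)) hs
      fun r hr => hder0 θ hθ x r ?_).symm
    exact le_norm_add_smul hθ hx (mul_nonneg hr.1 hxθ)

/-- the solution of the transport equation together with its inverse -/
theorem exists_transport_solution_inverse {A : R2 × R2 → E} (hA : ContDiff ℝ (⊤ : ℕ∞) A) {R : ℝ}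
    (hsupp : ∀ x θ, R ≤ ‖x‖ → A (x, θ) = 0) :
    ∃ c c' : R2 × R2 → E, ContDiff ℝ (⊤ : ℕ∞) c ∧ ContDiff ℝ (⊤ : ℕ∞) c' ∧ ∀ θ, ‖θ‖ = 1 →
      (∀ (x : R2) (s : ℝ), HasDerivAt (fun s : ℝ => c (x + s • θ, θ))
        (A (x + s • θ, θ) * c (x + s • θ, θ)) s) ∧
      (∀ (x : R2) (s : ℝ), HasDerivAt (fun s : ℝ => c' (x + s • θ, θ))
        (-(c' (x + s • θ, θ) * A (x + s • θ, θ))) s) ∧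
      (∀ x, c' (x, θ) * c (x, θ) = 1) ∧
      (∀ x, R ≤ ‖x‖ → inner ℝ x θ ≤ 0 → c (x, θ) = 1) ∧
      (∀ (x : R2) (s : ℝ), R ≤ ‖x‖ → 0 ≤ inner ℝ x θ → 0 ≤ s → c (x + s • θ, θ) = c (x, θ)) := by
  obtain ⟨c, hcs, hc⟩ := exists_transport_solution hA hsupp
  let e := MulOpposite.opContinuousLinearEquiv ℝ (M := E)
  obtain ⟨d, hds, hd⟩ := exists_transport_solution (E := Eᵐᵒᵖ) (A := fun p => -MulOpposite.op (A p))
    (e.contDiff.comp hA).neg (R := R) (fun x θ hx => by simp [hsupp x θ hx])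
  have hds' : ContDiff ℝ (⊤ : ℕ∞) (fun p => (d p).unop) := e.symm.contDiff.comp hds
  have hd' : ∀ θ, ‖θ‖ = 1 → ∀ (x : R2) (s : ℝ), HasDerivAt (fun s : ℝ => (d (x + s • θ, θ)).unop)
      (-((d (x + s • θ, θ)).unop * A (x + s • θ, θ))) s := by
    intro θ hθ x s
    have h := (e.symm : Eᵐᵒᵖ →L[ℝ] E).hasFDerivAt.comp_hasDerivAt s ((hd θ hθ).1 x s)
    refine h.congr_deriv ?_
    change MulOpposite.unop _ = _
    erw [neg_mul, MulOpposite.unop_neg, MulOpposite.unop_mul]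
    rfl
  refine ⟨c, fun p => (d p).unop, hcs, hds', fun θ hθ => ⟨(hc θ hθ).1, hd' θ hθ, fun x => ?_,
    (hc θ hθ).2.1, (hc θ hθ).2.2⟩⟩
  set r : ℝ := |inner ℝ x θ| + |R| with hr
  have hprod : ∀ s : ℝ, HasDerivAt (fun s : ℝ => (d (x + s • θ, θ)).unop * c (x + s • θ, θ)) 0 s := by
    intro s
    have h := (hd' θ hθ x s).mul ((hc θ hθ).1 x s)
    refine h.congr_deriv ?_
    rw [neg_mul, mul_assoc, neg_add_cancel]
  have h1 := eq_of_hasDerivAt_zero (f := fun s : ℝ => (d (x + s • θ, θ)).unop * c (x + s • θ, θ))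
    (a := -r) (b := 0) (by rw [hr, neg_nonpos]; positivity) fun s _ => hprod s
  have hin : inner ℝ (x + (-r) • θ) θ ≤ -|R| := by
    rw [inner_add_smul hθ]
    linarith [le_abs_self (inner ℝ x θ)]
  have hn : R ≤ ‖x + (-r) • θ‖ :=
    le_norm_of_inner_le hθ (hin.trans (neg_le_neg (le_abs_self R)))
  have hin0 : inner ℝ (x + (-r) • θ) θ ≤ 0 := hin.trans (neg_nonpos.2 (abs_nonneg R))
  simp only [zero_smul, add_zero] at h1
  rw [← h1, (hc θ hθ).2.1 _ hn hin0, (hd θ hθ).2.1 _ hn hin0]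
  simp

end TransportSolution

lemma exists_matrix_transport_solution {m : ℕ} {A : R2 × R2 → Mat m}
    (hA : ∀ i j, ContDiff ℝ (⊤ : ℕ∞) fun p => A p i j) {R : ℝ}
    (hsupp : ∀ x θ, R ≤ ‖x‖ → A (x, θ) = 0) :
    ∃ c c' : R2 × R2 → Mat m, (∀ i j, ContDiff ℝ (⊤ : ℕ∞) fun p => c p i j) ∧
      (∀ i j, ContDiff ℝ (⊤ : ℕ∞) fun p => c' p i j) ∧ ∀ θ, ‖θ‖ = 1 →
      (∀ x i j, HasDerivAt (fun s : ℝ => c (x + s • θ, θ) i j) ((A (x, θ) * c (x, θ)) i j) 0) ∧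
      (∀ x i j, HasDerivAt (fun s : ℝ => c' (x + s • θ, θ) i j)
        ((-(c' (x, θ) * A (x, θ))) i j) 0) ∧
      (∀ x, c' (x, θ) * c (x, θ) = 1) ∧
      (∀ x, R ≤ ‖x‖ → inner ℝ x θ ≤ 0 → c (x, θ) = 1) ∧
      (∀ (x : R2) (s : ℝ), R ≤ ‖x‖ → 0 ≤ inner ℝ x θ → 0 ≤ s →
        c (x + s • θ, θ) = c (x, θ)) := by
  let _ : NormedRing (Mat m) := Matrix.linftyOpNormedRing
  let _ : NormedAlgebra ℝ (Mat m) := Matrix.linftyOpNormedAlgebra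
  have : CompleteSpace (Mat m) := FiniteDimensional.complete ℝ (Mat m)
  have hA' : ContDiff ℝ (⊤ : ℕ∞) A := by
    have h : A = fun p => ∑ i, ∑ j, ((LinearMap.toContinuousLinearMap
        ((Matrix.singleLinearMap ℝ i j : ℂ →ₗ[ℝ] Mat m))) (A p i j)) := by
      funext p
      exact Matrix.matrix_eq_sum_single (A p)
    rw [h]
    exact ContDiff.sum fun i _ => ContDiff.sum fun j _ =>
      (ContinuousLinearMap.contDiff _).comp (hA i j)
  obtain ⟨c, c', hcs, hcs', h⟩ := exists_transport_solution_inverse hA' hsupp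
  let ent : Fin m → Fin m → (Mat m →L[ℝ] ℂ) := fun i j =>
    LinearMap.toContinuousLinearMap (Matrix.entryLinearMap ℝ ℂ i j)
  refine ⟨c, c', fun i j => (ent i j).contDiff.comp hcs, fun i j => (ent i j).contDiff.comp hcs',
    fun θ hθ => ⟨fun x i j => ?_, fun x i j => ?_, (h θ hθ).2.2⟩⟩
  · have h1 := (ent i j).hasFDerivAt.comp_hasDerivAt 0 ((h θ hθ).1 x 0)
    rw [zero_smul, add_zero] at h1
    exact h1
  · have h1 := (ent i j).hasFDerivAt.comp_hasDerivAt 0 ((h θ hθ).2.1 x 0)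
    rw [zero_smul, add_zero] at h1
    exact h1

lemma contDiff_Acomb {m : ℕ} {A : Fin 3 → R2 → Mat m} (hA : ∀ j, MatSmooth (A j)) (i j : Fin m) :
    ContDiff ℝ (⊤ : ℕ∞) fun p : R2 × R2 =>
      Acomb (A 0) (A 1) (A 2) (p.2 0) (p.2 1) p.1 i j := by
  have hco : ∀ k : Fin 2, ContDiff ℝ (⊤ : ℕ∞) fun p : R2 × R2 => ((p.2 k : ℝ) : ℂ) := fun k =>
    ofRealCLM.contDiff.comp (((EuclideanSpace.proj k : R2 →L[ℝ] ℝ).contDiff).comp contDiff_snd)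
  have hAk : ∀ k, ContDiff ℝ (⊤ : ℕ∞) fun p : R2 × R2 => A k p.1 i j := fun k =>
    (hA k i j).comp contDiff_fst
  simp only [Acomb, Matrix.add_apply, Matrix.smul_apply, smul_eq_mul]
  exact (((hco 0).mul (hAk 1)).add ((hco 1).mul (hAk 2))).add (hAk 0)

lemma tendsto_atBot_of_transport {m : ℕ} {c : R2 → Mat m} {R : ℝ} {θ : R2} (hθ : ‖θ‖ = 1)
    (hc : ∀ x, R ≤ ‖x‖ → inner ℝ x θ ≤ 0 → c x = 1) (x : R2) :
    Tendsto (fun s : ℝ => c (x + s • θ)) atBot (𝓝 1) := by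
  refine tendsto_const_nhds.congr' ?_
  filter_upwards [eventually_le_atBot (-|R| - |inner ℝ x θ|)] with s hs
  have hin : inner ℝ (x + s • θ) θ ≤ -|R| := by
    rw [inner_add_smul hθ]
    linarith [le_abs_self (inner ℝ x θ)]
  exact (hc _ (le_norm_of_inner_le hθ (hin.trans (neg_le_neg (le_abs_self R))))
    (hin.trans (neg_nonpos.2 (abs_nonneg R)))).symm

/-- The quotient of two transport solutions with the same scattering data. -/
theorem exists_gauge_family {m : ℕ} {R : ℝ} {A B : Fin 3 → R2 → Mat m}
    (hAsm : ∀ j, MatSmooth (A j)) (hBsm : ∀ j, MatSmooth (B j))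
    (hAsupp : ∀ j, SuppIn (A j) R) (hBsupp : ∀ j, SuppIn (B j) R)
    (hRadon : ∀ θ : R2, ‖θ‖ = 1 → ∀ cA cB : R2 → Mat m,
      Transport (Acomb (A 0) (A 1) (A 2) (θ 0) (θ 1)) θ cA →
      Transport (Acomb (B 0) (B 1) (B 2) (θ 0) (θ 1)) θ cB →
      (∀ x : R2, Filter.Tendsto (fun s : ℝ => cA (x + s • θ)) Filter.atBot (nhds 1)) →
      (∀ x : R2, Filter.Tendsto (fun s : ℝ => cB (x + s • θ)) Filter.atBot (nhds 1)) →
      ∀ x : R2, ∀ LA LB : Mat m,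
        Filter.Tendsto (fun s : ℝ => cA (x + s • θ)) Filter.atTop (nhds LA) →
        Filter.Tendsto (fun s : ℝ => cB (x + s • θ)) Filter.atTop (nhds LB) →
        LA = LB) :
    ∃ G : R2 × R2 → Mat m, (∀ i j, ContDiff ℝ (⊤ : ℕ∞) fun p => G p i j) ∧ ∀ θ, ‖θ‖ = 1 →
      (∀ x, (G (x, θ)).det ≠ 0) ∧ (∀ x, R ≤ ‖x‖ → G (x, θ) = 1) ∧
      ∀ x i j, HasDerivAt (fun s : ℝ => G (x + s • θ, θ) i j)
        ((Acomb (B 0) (B 1) (B 2) (θ 0) (θ 1) x * G (x, θ)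
          - G (x, θ) * Acomb (A 0) (A 1) (A 2) (θ 0) (θ 1) x) i j) 0 := by
  have hzero : ∀ {A : Fin 3 → R2 → Mat m}, (∀ j, SuppIn (A j) R) → ∀ x θ : R2, R ≤ ‖x‖ →
      Acomb (A 0) (A 1) (A 2) (θ 0) (θ 1) x = 0 := by
    intro A hA x θ hx
    simp [Acomb, hA _ x hx]
  obtain ⟨cA, cA', hcAs, hcAs', hcA⟩ := exists_matrix_transport_solution
    (contDiff_Acomb hAsm) (hzero hAsupp)
  obtain ⟨cB, cB', hcBs, hcBs', hcB⟩ := exists_matrix_transport_solution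
    (contDiff_Acomb hBsm) (hzero hBsupp)
  refine ⟨fun p => cB p * cA' p, fun i j => ?_, fun θ hθ => ?_⟩
  · simp only [Matrix.mul_apply]
    exact ContDiff.sum fun k _ => (hcBs i k).mul (hcAs' k j)
  obtain ⟨hA1, hA2, hA3, hA4, hA5⟩ := hcA θ hθ
  obtain ⟨hB1, hB2, hB3, hB4, hB5⟩ := hcB θ hθ
  have hinvA : ∀ x, cA (x, θ) * cA' (x, θ) = 1 := fun x => mul_eq_one_comm.1 (hA3 x)
  refine ⟨fun x => ?_, fun x hx => ?_, fun x i j => ?_⟩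
  · have h : (cA (x, θ) * cB' (x, θ)) * (cB (x, θ) * cA' (x, θ)) = 1 := by
      rw [mul_assoc, ← mul_assoc (cB' (x, θ)), hB3, one_mul, hinvA]
    exact (Matrix.isUnit_det_of_left_inverse h).ne_zero
  · have heq : cA (x, θ) = cB (x, θ) := by
      rcases le_total (inner ℝ x θ) 0 with h | h
      · rw [hA4 x hx h, hB4 x hx h]
      · refine hRadon θ hθ (fun x => cA (x, θ)) (fun x => cB (x, θ)) hA1 hB1
          (tendsto_atBot_of_transport hθ hA4) (tendsto_atBot_of_transport hθ hB4) x _ _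
          (tendsto_const_nhds.congr' ?_) (tendsto_const_nhds.congr' ?_)
        · filter_upwards [eventually_ge_atTop 0] with s hs using (hA5 x s hx h hs).symm
        · filter_upwards [eventually_ge_atTop 0] with s hs using (hB5 x s hx h hs).symm
    change cB (x, θ) * cA' (x, θ) = 1
    rw [← heq, hinvA]
  · have h : HasDerivAt (fun s : ℝ => ∑ k, cB (x + s • θ, θ) i k * cA' (x + s • θ, θ) k j) _ 0 :=
      HasDerivAt.fun_sum fun k _ => (hB1 x i k).mul (hA2 x k j)
    refine h.congr_deriv ?_
    simp only [zero_smul, add_zero, Finset.sum_add_distrib, ← Matrix.mul_apply]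
    rw [← Matrix.add_apply]
    noncomm_ring

/-! ### Fourier modes in the direction variable -/

/-- the character `s ↦ e^{2πiks}` -/
def expMode (k : ℤ) (s : ℝ) : ℂ := Complex.exp (2 * Real.pi * Complex.I * k * s)

lemma expMode_add (k l : ℤ) (s : ℝ) : expMode (k + l) s = expMode k s * expMode l s := by
  rw [expMode, expMode, expMode, ← Complex.exp_add]
  push_cast
  ring_nf

lemma expMode_zero (k : ℤ) : expMode k 0 = 1 := by simp [expMode]

lemma expMode_one (k : ℤ) : expMode k 1 = 1 := by
  rw [expMode, Complex.exp_eq_one_iff]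
  exact ⟨k, by push_cast; ring⟩

lemma contDiff_expMode (k : ℤ) : ContDiff ℝ (⊤ : ℕ∞) (expMode k) :=
  (contDiff_const.mul ofRealCLM.contDiff).cexp

lemma hasDerivAt_expMode (k : ℤ) (s : ℝ) :
    HasDerivAt (expMode k) (2 * Real.pi * Complex.I * k * expMode k s) s := by
  have h := ((ofRealCLM.hasDerivAt (x := s)).const_mul (2 * Real.pi * Complex.I * (k : ℂ))).cexp
  refine h.congr_deriv ?_
  simp [expMode]
  ring

lemma norm_expMode (k : ℤ) (s : ℝ) : ‖expMode k s‖ = 1 := by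
  rw [expMode, Complex.norm_exp]
  simp

lemma conj_expMode (k : ℤ) (s : ℝ) : (starRingEnd ℂ) (expMode k s) = expMode (-k) s := by
  rw [expMode, expMode, ← Complex.exp_conj]
  simp [Complex.conj_ofNat]

/-- the `k`-th Fourier coefficient in the first variable -/
def fmode (F : ℝ × R2 → ℂ) (k : ℤ) (x : R2) : ℂ := ∫ s in (0 : ℝ)..1, expMode (-k) s * F (s, x)

/-- derivative in the first variable -/
def dS (F : ℝ × R2 → ℂ) (p : ℝ × R2) : ℂ := fderiv ℝ F p (1, 0)

/-- derivative in the second variable -/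
def dX (v : R2) (F : ℝ × R2 → ℂ) (p : ℝ × R2) : ℂ := fderiv ℝ F p (0, v)

/-- smooth functions, periodic in the first variable -/
structure SmoothPeriodic (F : ℝ × R2 → ℂ) : Prop where
  smooth : ContDiff ℝ (⊤ : ℕ∞) F
  periodic : ∀ s x, F (s + 1, x) = F (s, x)

lemma SmoothPeriodic.fderiv_apply {F : ℝ × R2 → ℂ} (h : SmoothPeriodic F) (w : ℝ × R2) :
    SmoothPeriodic fun p => fderiv ℝ F p w := by
  refine ⟨(h.smooth.fderiv_right (by simp)).clm_apply contDiff_const, fun s x => ?_⟩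
  have hF : (fun p : ℝ × R2 => F (p + (1, 0))) = F := by
    funext p
    obtain ⟨s, x⟩ := p
    simpa using h.periodic s x
  have h2 := fderiv_comp_add_right (𝕜 := ℝ) (f := F) (x := (s, x)) ((1 : ℝ), (0 : R2))
  rw [hF] at h2
  simp [h2]

lemma SmoothPeriodic.dS {F : ℝ × R2 → ℂ} (h : SmoothPeriodic F) : SmoothPeriodic (dS F) :=
  h.fderiv_apply _

lemma SmoothPeriodic.dX {F : ℝ × R2 → ℂ} (h : SmoothPeriodic F) (v : R2) :
    SmoothPeriodic (dX v F) := h.fderiv_apply _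

lemma SmoothPeriodic.conj {F : ℝ × R2 → ℂ} (h : SmoothPeriodic F) :
    SmoothPeriodic fun p => (starRingEnd ℂ) (F p) :=
  ⟨contDiff_conj h.smooth, fun s x => by rw [h.periodic]⟩

lemma hasDerivAt_dS {F : ℝ × R2 → ℂ} (h : ContDiff ℝ (⊤ : ℕ∞) F) (s : ℝ) (x : R2) :
    HasDerivAt (fun s => F (s, x)) (dS F (s, x)) s :=
  (h.differentiable (by simp) (s, x)).hasFDerivAt.comp_hasDerivAt s
    ((hasDerivAt_id s).prodMk (hasDerivAt_const s x))

lemma dX_eq_pdv {F : ℝ × R2 → ℂ} (h : ContDiff ℝ (⊤ : ℕ∞) F) (v : R2) (s : ℝ) (x : R2) :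
    dX v F (s, x) = pdv v (fun y => F (s, y)) x := by
  have h1 := (h.differentiable (by simp) (s, x)).hasFDerivAt.comp x
    ((hasFDerivAt_const s x).prodMk (hasFDerivAt_id x))
  have h2 : fderiv ℝ (fun y => F (s, y)) x = _ := h1.fderiv
  rw [pdv, h2]
  simp [dX]

lemma contDiff_mode_integrand {F : ℝ × R2 → ℂ} (h : ContDiff ℝ (⊤ : ℕ∞) F) (k : ℤ) :
    ContDiff ℝ (⊤ : ℕ∞) fun p : ℝ × R2 => expMode (-k) p.1 * F (p.1, p.2) :=
  ((contDiff_expMode _).comp contDiff_fst).mul h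

lemma contDiff_fmode {F : ℝ × R2 → ℂ} (h : ContDiff ℝ (⊤ : ℕ∞) F) (k : ℤ) :
    ContDiff ℝ (⊤ : ℕ∞) (fmode F k) :=
  (contDiff_integral_param (contDiff_mode_integrand h k)).1

lemma pdv_fmode {F : ℝ × R2 → ℂ} (h : ContDiff ℝ (⊤ : ℕ∞) F) (k : ℤ) (v x : R2) :
    pdv v (fmode F k) x = fmode (dX v F) k x := by
  refine ((contDiff_integral_param (contDiff_mode_integrand h k)).2 x v).trans ?_
  refine intervalIntegral.integral_congr fun s _ => ?_
  have hd : DifferentiableAt ℝ (fun y => F (s, y)) x :=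
    (h.comp (contDiff_const.prodMk contDiff_id)).differentiable (by simp) x
  exact (pdv_const_mul hd (expMode (-k) s) v).trans (by rw [dX_eq_pdv h])

lemma intervalIntegrable_mode {F : ℝ × R2 → ℂ} (h : ContDiff ℝ (⊤ : ℕ∞) F) (k : ℤ) (x : R2)
    (a b : ℝ) : IntervalIntegrable (fun s => expMode k s * F (s, x)) volume a b := by
  have h1 := (contDiff_expMode k).continuous
  have h2 := h.continuous
  exact Continuous.intervalIntegrable (by fun_prop) _ _

lemma fmode_dS {F : ℝ × R2 → ℂ} (h : SmoothPeriodic F) (k : ℤ) (x : R2) :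
    fmode (dS F) k x = 2 * Real.pi * Complex.I * k * fmode F k x := by
  have hi : IntervalIntegrable (fun s => 2 * Real.pi * Complex.I * ((-k : ℤ) : ℂ) * expMode (-k) s)
      volume 0 1 :=
    Continuous.intervalIntegrable (continuous_const.mul (contDiff_expMode _).continuous) _ _
  have hi2 : IntervalIntegrable (fun s => dS F (s, x)) volume 0 1 := by
    have := h.dS.smooth.continuous
    exact Continuous.intervalIntegrable (by fun_prop) _ _
  have hib := intervalIntegral.integral_mul_deriv_eq_deriv_mul
    (fun s _ => hasDerivAt_expMode (-k) s) (fun s _ => hasDerivAt_dS h.smooth s x) hi hi2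
  have hper := h.periodic 0 x
  rw [zero_add] at hper
  rw [fmode, hib, expMode_zero, expMode_one, hper, sub_self, zero_sub, fmode,
    ← intervalIntegral.integral_neg, ← intervalIntegral.integral_const_mul]
  refine intervalIntegral.integral_congr fun s _ => ?_
  push_cast
  ring

lemma fmode_eq_zero_of_dS {F : ℝ × R2 → ℂ} (h : SmoothPeriodic F) {k : ℤ} (hk : k ≠ 0) {x : R2}
    (h0 : ∀ s, dS F (s, x) = 0) : fmode F k x = 0 := by
  have h1 := fmode_dS h k x
  have h2 : fmode (dS F) k x = 0 := by simp [fmode, h0]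
  rw [h2] at h1
  have h3 : (2 * Real.pi * Complex.I * k : ℂ) ≠ 0 := by
    simp [Real.pi_ne_zero, hk]
  exact (mul_eq_zero.1 h1.symm).resolve_left h3

lemma fmode_bound {F : ℝ × R2 → ℂ} (h : ContDiff ℝ (⊤ : ℕ∞) F) (R : ℝ) :
    ∃ D : ℝ, ∀ k x, ‖x‖ ≤ R → ‖fmode F k x‖ ≤ D := by
  obtain ⟨D, hD⟩ := ((isCompact_Icc (a := (0 : ℝ)) (b := 1)).prod
    (isCompact_closedBall (0 : R2) R)).exists_bound_of_continuousOn h.continuous.continuousOn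
  refine ⟨D, fun k x hx => ?_⟩
  have := intervalIntegral.norm_integral_le_of_norm_le_const (a := 0) (b := 1) (C := D)
    (f := fun s => expMode (-k) s * F (s, x)) fun s hs => by
      rw [norm_mul, norm_expMode, one_mul]
      rw [Set.uIoc_of_le zero_le_one] at hs
      exact hD (s, x) ⟨⟨hs.1.le, hs.2⟩, by simpa using hx⟩
  simpa [fmode] using this

lemma fmode_decay (R : ℝ) (n : ℕ) : ∀ {F : ℝ × R2 → ℂ}, SmoothPeriodic F →
    ∃ D : ℝ, ∀ (k : ℤ) x, ‖x‖ ≤ R → |(k : ℝ)| ^ n * ‖fmode F k x‖ ≤ D := by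
  induction n with
  | zero =>
    intro F h
    obtain ⟨D, hD⟩ := fmode_bound h.smooth R
    exact ⟨D, fun k x hx => by simpa using hD k x hx⟩
  | succ n ih =>
    intro F h
    obtain ⟨D, hD⟩ := ih h.dS
    refine ⟨D, fun k x hx => le_trans ?_ (hD k x hx)⟩
    rw [fmode_dS h, pow_succ, mul_assoc]
    gcongr
    rw [norm_mul]
    gcongr
    simp only [norm_mul, Complex.norm_I, Complex.norm_intCast, Complex.norm_real, mul_one]
    rw [Real.norm_of_nonneg Real.pi_pos.le]
    have : (1 : ℝ) ≤ ‖(2 : ℂ)‖ * Real.pi := by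
      simp
      linarith [Real.pi_gt_three]
    nlinarith [abs_nonneg (k : ℝ)]

lemma fmode_expMode_mul (F : ℝ × R2 → ℂ) (l k : ℤ) (x : R2) :
    fmode (fun p => expMode l p.1 * F p) k x = fmode F (k - l) x := by
  refine intervalIntegral.integral_congr fun s _ => ?_
  simp only
  rw [← mul_assoc, ← expMode_add]
  ring_nf

lemma fmode_conj (F : ℝ × R2 → ℂ) (k : ℤ) (x : R2) :
    fmode (fun p => (starRingEnd ℂ) (F p)) k x = (starRingEnd ℂ) (fmode F (-k) x) := by
  rw [fmode, fmode, ← intervalIntegral.intervalIntegral_conj]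
  refine intervalIntegral.integral_congr fun s _ => ?_
  simp [conj_expMode]

lemma eq_of_fmode_eq_zero {F : ℝ × R2 → ℂ} (h : SmoothPeriodic F) {x : R2}
    (h0 : ∀ k : ℤ, k ≠ 0 → fmode F k x = 0) (s : ℝ) : F (s, x) = F (0, x) := by
  have hp : Function.Periodic (fun s => F (s, x)) 1 := fun s => h.periodic s x
  have hc : Continuous fun s => F (s, x) := by
    have := h.smooth.continuous
    fun_prop
  let f : C(AddCircle (1 : ℝ), ℂ) := ⟨hp.lift, continuous_coinduced_dom.2 hc⟩
  have hf : ∀ s : ℝ, f s = F (s, x) := fun s => rfl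
  have hco : ∀ k, fourierCoeff f k = fmode F k x := by
    intro k
    rw [fourierCoeff_eq_intervalIntegral _ k 0]
    simp only [fourier_coe_apply, hf, zero_add, div_one, one_smul, smul_eq_mul, fmode, expMode,
      Complex.ofReal_one]
  have hz : ∀ k : ℤ, k ≠ 0 → fourierCoeff f k = 0 := fun k hk => by rw [hco, h0 k hk]
  have hs : Summable (fourierCoeff f) :=
    summable_of_ne_finset_zero (s := {0}) fun k hk => hz k (by simpa using hk)
  have h1 := hasSum_fourier_series_of_summable hs
  have h3 : f = fourierCoeff f 0 • fourier 0 := h1.unique <| hasSum_single 0 fun k hk => by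
    ext
    simp [hz k hk]
  have h4 : ∀ s : ℝ, F (s, x) = fourierCoeff f 0 := by
    intro s
    rw [← hf]
    conv_lhs => rw [h3]
    simp
  rw [h4, h4]

lemma fmode_add {F G : ℝ × R2 → ℂ} (hF : ContDiff ℝ (⊤ : ℕ∞) F) (hG : ContDiff ℝ (⊤ : ℕ∞) G)
    (k : ℤ) (x : R2) : fmode (fun p => F p + G p) k x = fmode F k x + fmode G k x := by
  simp only [fmode, mul_add]
  exact intervalIntegral.integral_add (intervalIntegrable_mode hF _ x _ _)
    (intervalIntegrable_mode hG _ x _ _)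

lemma fmode_const_mul (F : ℝ × R2 → ℂ) (c : ℂ) (k : ℤ) (x : R2) :
    fmode (fun p => c * F p) k x = c * fmode F k x := by
  rw [fmode, fmode, ← intervalIntegral.integral_const_mul]
  refine intervalIntegral.integral_congr fun s _ => ?_
  ring

lemma fmode_sum {ι : Type} [Fintype ι] {F : ι → ℝ × R2 → ℂ}
    (hF : ∀ l, ContDiff ℝ (⊤ : ℕ∞) (F l)) (k : ℤ) (x : R2) :
    fmode (fun p => ∑ l, F l p) k x = ∑ l, fmode (F l) k x := by
  simp only [fmode, Finset.mul_sum]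
  exact intervalIntegral.integral_finsetSum fun l _ => intervalIntegrable_mode (hF l) _ x _ _

lemma contDiff_expMode_mul {F : ℝ × R2 → ℂ} (hF : ContDiff ℝ (⊤ : ℕ∞) F) (k : ℤ) :
    ContDiff ℝ (⊤ : ℕ∞) fun p : ℝ × R2 => expMode k p.1 * F p :=
  ((contDiff_expMode k).comp contDiff_fst).mul hF

/-- The Fourier modes of a solution of the transport system satisfy a tridiagonal system. -/
lemma fmode_system {ι : Type} [Fintype ι] {F : ι → ℝ × R2 → ℂ} (hF : ∀ l, SmoothPeriodic (F l))
    {a b c : ι → ι → R2 → ℂ}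
    (heq : ∀ l s x, expMode 1 s * ((dX e1 (F l) (s, x) - Complex.I * dX e2 (F l) (s, x)) / 2)
      + expMode (-1) s * ((dX e1 (F l) (s, x) + Complex.I * dX e2 (F l) (s, x)) / 2)
      = ∑ l', (a l l' x * expMode 1 s + b l l' x * expMode (-1) s + c l l' x) * F l' (s, x))
    (l : ι) (k : ℤ) (x : R2) :
    dz (fmode (F l) (k - 1)) x + dzbar (fmode (F l) (k + 1)) x
      = ∑ l', (a l l' x * fmode (F l') (k - 1) x + b l l' x * fmode (F l') (k + 1) x
        + c l l' x * fmode (F l') k x) := by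
  have hs := fun l => (hF l).smooth
  have hX := fun l v => ((hF l).dX v).smooth
  have hD1 : ContDiff ℝ (⊤ : ℕ∞) fun p =>
      1 / 2 * dX e1 (F l) p + -Complex.I / 2 * dX e2 (F l) p :=
    (contDiff_const.mul (hX l e1)).add (contDiff_const.mul (hX l e2))
  have hD2 : ContDiff ℝ (⊤ : ℕ∞) fun p =>
      1 / 2 * dX e1 (F l) p + Complex.I / 2 * dX e2 (F l) p :=
    (contDiff_const.mul (hX l e1)).add (contDiff_const.mul (hX l e2))
  have hL : fmode (fun p => expMode 1 p.1 * (1 / 2 * dX e1 (F l) p + -Complex.I / 2 * dX e2 (F l) p)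
      + expMode (-1) p.1 * (1 / 2 * dX e1 (F l) p + Complex.I / 2 * dX e2 (F l) p)) k x
      = dz (fmode (F l) (k - 1)) x + dzbar (fmode (F l) (k + 1)) x := by
    rw [fmode_add (contDiff_expMode_mul hD1 1) (contDiff_expMode_mul hD2 (-1)),
      fmode_expMode_mul, fmode_expMode_mul,
      fmode_add (contDiff_const.mul (hX l e1)) (contDiff_const.mul (hX l e2)),
      fmode_add (contDiff_const.mul (hX l e1)) (contDiff_const.mul (hX l e2)),
      fmode_const_mul, fmode_const_mul, fmode_const_mul, fmode_const_mul, dz, dzbar,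
      pdv_fmode (hs l), pdv_fmode (hs l), pdv_fmode (hs l), pdv_fmode (hs l), sub_neg_eq_add]
    ring
  have hR : fmode (fun p => ∑ l', (a l l' x * (expMode 1 p.1 * F l' p)
      + b l l' x * (expMode (-1) p.1 * F l' p) + c l l' x * F l' p)) k x
      = ∑ l', (a l l' x * fmode (F l') (k - 1) x + b l l' x * fmode (F l') (k + 1) x
        + c l l' x * fmode (F l') k x) := by
    have h1 := fun l' => contDiff_const (c := a l l' x) |>.mul (contDiff_expMode_mul (hs l') 1)
    have h2 := fun l' => contDiff_const (c := b l l' x) |>.mul (contDiff_expMode_mul (hs l') (-1))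
    have h3 := fun l' => contDiff_const (c := c l l' x) |>.mul (hs l')
    rw [fmode_sum fun l' => ((h1 l').add (h2 l')).add (h3 l')]
    refine Finset.sum_congr rfl fun l' _ => ?_
    rw [fmode_add ((h1 l').add (h2 l')) (h3 l'), fmode_add (h1 l') (h2 l'), fmode_const_mul,
      fmode_const_mul, fmode_const_mul, fmode_expMode_mul, fmode_expMode_mul, sub_neg_eq_add]
  rw [← hL, ← hR]
  refine intervalIntegral.integral_congr fun s _ => ?_
  simp only
  congr 1
  refine Eq.trans ?_ ((heq l s x).trans (Finset.sum_congr rfl fun l' _ => ?_))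
  · ring
  · ring

lemma norm_dzbar_le (f : R2 → ℂ) (x : R2) : ‖dzbar f x‖ ≤ ‖pdv e1 f x‖ + ‖pdv e2 f x‖ := by
  rw [dzbar, norm_div, Complex.norm_ofNat]
  have h := norm_add_le (pdv e1 f x) (Complex.I * pdv e2 f x)
  rw [norm_mul, Complex.norm_I, one_mul] at h
  linarith [norm_nonneg (pdv e1 f x + Complex.I * pdv e2 f x)]

theorem positive_modes_eq_zero {ι : Type} [Fintype ι] {F : ι → ℝ × R2 → ℂ}
    (hF : ∀ l, SmoothPeriodic (F l)) {R C : ℝ} (hR : 0 < R) (hC : 0 ≤ C)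
    (hout : ∀ l s x, R ≤ ‖x‖ → dS (F l) (s, x) = 0) {a b c : ι → ι → R2 → ℂ}
    (ha : ∀ l l' x, ‖a l l' x‖ ≤ C) (hb : ∀ l l' x, ‖b l l' x‖ ≤ C) (hc : ∀ l l' x, ‖c l l' x‖ ≤ C)
    (heq : ∀ l s x, expMode 1 s * ((dX e1 (F l) (s, x) - Complex.I * dX e2 (F l) (s, x)) / 2)
      + expMode (-1) s * ((dX e1 (F l) (s, x) + Complex.I * dX e2 (F l) (s, x)) / 2)
      = ∑ l', (a l l' x * expMode 1 s + b l l' x * expMode (-1) s + c l l' x) * F l' (s, x))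
    (l : ι) (j : ℕ) (x : R2) : fmode (F l) (j + 1) x = 0 := by
  have hk : ∀ j : ℕ, ((j : ℤ) + 1) ≠ 0 := fun j => by positivity
  have hz : ∀ l (j : ℕ) x, R ≤ ‖x‖ → fmode (F l) (j + 1) x = 0 := fun l j x hx =>
    fmode_eq_zero_of_dS (hF l) (hk j) fun s => hout l s x hx
  refine modes_unique_continuation (w := fun l j => fmode (F l) ((j : ℤ) + 1)) hR hC
    (fun l j => contDiff_fmode (hF l).smooth _) hz (fun n => ?_) (fun l j x => ?_) l j x
  · choose D0 hD0 using fun l => fmode_decay R n (hF l)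
    choose D1 hD1 using fun l => fmode_decay R n ((hF l).dX e1)
    choose D2 hD2 using fun l => fmode_decay R n ((hF l).dX e2)
    have hle : ∀ l, |D0 l| + |D1 l| + |D2 l| ≤ ∑ l, (|D0 l| + |D1 l| + |D2 l|) := fun l =>
      Finset.single_le_sum (f := fun l => |D0 l| + |D1 l| + |D2 l|) (fun l _ => by positivity)
        (Finset.mem_univ l)
    refine ⟨∑ l, (|D0 l| + |D1 l| + |D2 l|), fun l j x => ?_⟩
    have h0 := fun hx => (hD0 l (j + 1) x hx).trans (le_abs_self _)
    have h1 := fun hx => (hD1 l (j + 1) x hx).trans (le_abs_self _)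
    have h2 := fun hx => (hD2 l (j + 1) x hx).trans (le_abs_self _)
    have hcast : |((((j : ℤ) + 1 : ℤ)) : ℝ)| = (j : ℝ) + 1 := by
      push_cast
      exact abs_of_nonneg (by positivity)
    rw [hcast] at h0 h1 h2
    have hl := hle l
    have p0 := abs_nonneg (D0 l)
    have p1 := abs_nonneg (D1 l)
    have p2 := abs_nonneg (D2 l)
    rcases le_or_gt ‖x‖ R with hx | hx
    · refine ⟨by linarith [h0 hx], ?_⟩
      have h3 := norm_dzbar_le (fmode (F l) ((j : ℤ) + 1)) x
      rw [pdv_fmode (hF l).smooth, pdv_fmode (hF l).smooth] at h3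
      have h4 := mul_le_mul_of_nonneg_left h3 (by positivity : 0 ≤ ((j : ℝ) + 1) ^ n)
      rw [mul_add] at h4
      linarith [h1 hx, h2 hx]
    · have hd : dzbar (fmode (F l) ((j : ℤ) + 1)) x = 0 := by
        rw [dzbar, pdv_eq_zero_of_norm_gt (hz l j) hx, pdv_eq_zero_of_norm_gt (hz l j) hx]
        simp
      simp only [hz l j x hx.le, hd, norm_zero, mul_zero]
      constructor <;> linarith
  · have h := fmode_system hF heq l ((j : ℤ) + 1 + 1) x
    have e1 : (j : ℤ) + 1 + 1 - 1 = (j : ℤ) + 1 := by ring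
    have e2 : (j : ℤ) + 1 + 1 + 1 = ((j + 2 : ℕ) : ℤ) + 1 := by push_cast; ring
    have e3 : (j : ℤ) + 1 + 1 = ((j + 1 : ℕ) : ℤ) + 1 := by push_cast; ring
    rw [e1, e2, e3] at h
    rw [h, Finset.mul_sum]
    refine (norm_sum_le _ _).trans (Finset.sum_le_sum fun l' _ => ?_)
    refine (norm_add₃_le).trans ?_
    simp only [norm_mul]
    have h1 := mul_le_mul_of_nonneg_right (ha l l' x) (norm_nonneg (fmode (F l') ((j : ℤ) + 1) x))
    have h2 := mul_le_mul_of_nonneg_right (hb l l' x)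
      (norm_nonneg (fmode (F l') (((j + 2 : ℕ) : ℤ) + 1) x))
    have h3 := mul_le_mul_of_nonneg_right (hc l l' x)
      (norm_nonneg (fmode (F l') (((j + 1 : ℕ) : ℤ) + 1) x))
    linarith

lemma dX_conj {F : ℝ × R2 → ℂ} (hF : SmoothPeriodic F) (v : R2) (s : ℝ) (x : R2) :
    dX v (fun p => (starRingEnd ℂ) (F p)) (s, x) = (starRingEnd ℂ) (dX v F (s, x)) := by
  rw [dX_eq_pdv hF.conj.smooth, dX_eq_pdv hF.smooth]
  exact pdv_conj ((hF.smooth.comp (contDiff_const.prodMk contDiff_id)).differentiable (by simp) x) v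

lemma dS_conj {F : ℝ × R2 → ℂ} (hF : SmoothPeriodic F) (s : ℝ) (x : R2) :
    dS (fun p => (starRingEnd ℂ) (F p)) (s, x) = (starRingEnd ℂ) (dS F (s, x)) :=
  (hasDerivAt_dS hF.conj.smooth s x).unique ((hasDerivAt_dS hF.smooth s x).star)

/-- Solutions of the transport system which are constant outside a ball do not depend on the
direction. -/
theorem transport_system_direction_independent {ι : Type} [Fintype ι] {F : ι → ℝ × R2 → ℂ}
    (hF : ∀ l, SmoothPeriodic (F l)) {R C : ℝ} (hR : 0 < R) (hC : 0 ≤ C)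
    (hout : ∀ l s x, R ≤ ‖x‖ → dS (F l) (s, x) = 0) {a b c : ι → ι → R2 → ℂ}
    (ha : ∀ l l' x, ‖a l l' x‖ ≤ C) (hb : ∀ l l' x, ‖b l l' x‖ ≤ C) (hc : ∀ l l' x, ‖c l l' x‖ ≤ C)
    (heq : ∀ l s x, expMode 1 s * ((dX e1 (F l) (s, x) - Complex.I * dX e2 (F l) (s, x)) / 2)
      + expMode (-1) s * ((dX e1 (F l) (s, x) + Complex.I * dX e2 (F l) (s, x)) / 2)
      = ∑ l', (a l l' x * expMode 1 s + b l l' x * expMode (-1) s + c l l' x) * F l' (s, x))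
    (l : ι) (s : ℝ) (x : R2) : F l (s, x) = F l (0, x) := by
  have hpos := positive_modes_eq_zero hF hR hC hout ha hb hc heq
  have hneg := positive_modes_eq_zero (fun l => (hF l).conj) hR hC
    (fun l s x hx => by rw [dS_conj (hF l), hout l s x hx, map_zero])
    (a := fun l l' x => (starRingEnd ℂ) (b l l' x)) (b := fun l l' x => (starRingEnd ℂ) (a l l' x))
    (c := fun l l' x => (starRingEnd ℂ) (c l l' x))
    (fun l l' x => by simpa using hb l l' x) (fun l l' x => by simpa using ha l l' x)
    (fun l l' x => by simpa using hc l l' x) (fun l s x => by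
      have h := congrArg (starRingEnd ℂ) (heq l s x)
      simp only [map_sum, map_add, map_mul, map_div₀, map_sub, conj_expMode, Complex.conj_I,
        Complex.conj_ofNat, neg_neg] at h
      rw [dX_conj (hF l), dX_conj (hF l)]
      refine Eq.trans ?_ (h.trans (Finset.sum_congr rfl fun l' _ => ?_))
      · ring
      · ring)
  refine eq_of_fmode_eq_zero (hF l) (fun k hk => ?_) s
  obtain ⟨n, rfl | rfl⟩ := k.eq_nat_or_neg
  · obtain ⟨j, rfl⟩ := Nat.exists_eq_succ_of_ne_zero (by simpa using hk : n ≠ 0)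
    simpa using hpos l j x
  · obtain ⟨j, rfl⟩ := Nat.exists_eq_succ_of_ne_zero (by simpa using hk : n ≠ 0)
    have h := hneg l j x
    rw [fmode_conj] at h
    simpa using h

/-! ### The gauge transformation -/

/-- the unit vector of angle `2πs` -/
def unitDir (s : ℝ) : R2 := Real.cos (2 * Real.pi * s) • e1 + Real.sin (2 * Real.pi * s) • e2

lemma unitDir_zero (s : ℝ) : unitDir s 0 = Real.cos (2 * Real.pi * s) := by simp [unitDir]

lemma unitDir_one (s : ℝ) : unitDir s 1 = Real.sin (2 * Real.pi * s) := by simp [unitDir]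

lemma norm_unitDir (s : ℝ) : ‖unitDir s‖ = 1 := by
  rw [EuclideanSpace.norm_eq, Fin.sum_univ_two, unitDir_zero, unitDir_one]
  simp

lemma contDiff_unitDir : ContDiff ℝ (⊤ : ℕ∞) unitDir := by
  unfold unitDir
  fun_prop

lemma unitDir_add_one (s : ℝ) : unitDir (s + 1) = unitDir s := by
  simp only [unitDir, mul_add, mul_one, Real.cos_add_two_pi, Real.sin_add_two_pi]

lemma expMode_one_eq (s : ℝ) : expMode 1 s
    = (Real.cos (2 * Real.pi * s) : ℂ) + Real.sin (2 * Real.pi * s) * Complex.I := by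
  have h : (2 * Real.pi * Complex.I * ((1 : ℤ) : ℂ) * s : ℂ)
      = ((2 * Real.pi * s : ℝ) : ℂ) * Complex.I := by
    push_cast
    ring
  rw [expMode, h, Complex.exp_mul_I, Complex.ofReal_cos, Complex.ofReal_sin]

lemma expMode_neg_one_eq (s : ℝ) : expMode (-1) s
    = (Real.cos (2 * Real.pi * s) : ℂ) - Real.sin (2 * Real.pi * s) * Complex.I := by
  rw [← conj_expMode, expMode_one_eq, map_add, map_mul, Complex.conj_ofReal, Complex.conj_ofReal,
    Complex.conj_I]
  ring

/-- matrix coefficients of `G ↦ X G - G Y` -/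
def sylvesterCoef {m : ℕ} (X Y : Mat m) (l l' : Fin m × Fin m) : ℂ :=
  (if l'.2 = l.2 then X l.1 l'.1 else 0) - (if l'.1 = l.1 then Y l'.2 l.2 else 0)

lemma sum_sylvesterCoef {m : ℕ} (X Y G : Mat m) (l : Fin m × Fin m) :
    ∑ l', sylvesterCoef X Y l l' * G l'.1 l'.2 = (X * G - G * Y) l.1 l.2 := by
  simp only [sylvesterCoef, sub_mul, Finset.sum_sub_distrib, Fintype.sum_prod_type, ite_mul,
    zero_mul, Matrix.sub_apply, Matrix.mul_apply]
  congr 1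
  · simp
  · rw [Finset.sum_comm]
    simp [mul_comm]

lemma norm_sylvesterCoef_le {m : ℕ} {X Y : Mat m} {K : ℝ} (hX : ∀ i j, ‖X i j‖ ≤ K)
    (hY : ∀ i j, ‖Y i j‖ ≤ K) (l l' : Fin m × Fin m) : ‖sylvesterCoef X Y l l'‖ ≤ K + K := by
  have hK : 0 ≤ K := (norm_nonneg _).trans (hX l.1 l.1)
  refine (norm_sub_le _ _).trans (add_le_add ?_ ?_)
  · split_ifs
    · exact hX _ _
    · simpa
  · split_ifs
    · exact hY _ _
    · simpa

lemma exists_entry_bound {m : ℕ} {R : ℝ} {A : Fin 3 → R2 → Mat m} (hAsm : ∀ j, MatSmooth (A j))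
    (hAsupp : ∀ j, SuppIn (A j) R) : ∃ K : ℝ, 0 ≤ K ∧ ∀ k x i j, ‖A k x i j‖ ≤ K := by
  choose D hD using fun (k : Fin 3) (i j : Fin m) =>
    (isCompact_closedBall (0 : R2) R).exists_bound_of_continuousOn
      (hAsm k i j).continuous.continuousOn
  have hle : ∀ k i j, |D k i j| ≤ ∑ q : Fin 3 × Fin m × Fin m, |D q.1 q.2.1 q.2.2| := fun k i j =>
    Finset.single_le_sum (f := fun q : Fin 3 × Fin m × Fin m => |D q.1 q.2.1 q.2.2|)
      (fun q _ => abs_nonneg _) (Finset.mem_univ (k, i, j))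
  have h0 : 0 ≤ ∑ q : Fin 3 × Fin m × Fin m, |D q.1 q.2.1 q.2.2| :=
    Finset.sum_nonneg fun q _ => abs_nonneg _
  refine ⟨_, h0, fun k x i j => ?_⟩
  rcases le_total ‖x‖ R with hx | hx
  · exact ((hD k i j x (by simpa using hx)).trans (le_abs_self _)).trans (hle k i j)
  · simpa [hAsupp k x hx] using h0

lemma norm_half_add_le {u v : ℂ} {K : ℝ} (hu : ‖u‖ ≤ K) (hv : ‖v‖ ≤ K) {c : ℂ} (hc : ‖c‖ = 1) :
    ‖(1 / 2 : ℂ) * (u + c * v)‖ ≤ K := by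
  have h := norm_add_le u (c * v)
  rw [norm_mul c, hc, one_mul] at h
  rw [norm_mul]
  norm_num
  linarith

/-- The gauge family does not depend on the direction. -/
lemma gauge_family_direction_independent {m : ℕ} {R : ℝ} (hR : 0 < R) {A B : Fin 3 → R2 → Mat m}
    (hAsm : ∀ j, MatSmooth (A j)) (hBsm : ∀ j, MatSmooth (B j))
    (hAsupp : ∀ j, SuppIn (A j) R) (hBsupp : ∀ j, SuppIn (B j) R)
    {G : R2 × R2 → Mat m} (hG : ∀ i j, ContDiff ℝ (⊤ : ℕ∞) fun p => G p i j)
    (hout : ∀ θ, ‖θ‖ = 1 → ∀ x, R ≤ ‖x‖ → G (x, θ) = 1)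
    (hder : ∀ θ, ‖θ‖ = 1 → ∀ x i j, HasDerivAt (fun s : ℝ => G (x + s • θ, θ) i j)
        ((Acomb (B 0) (B 1) (B 2) (θ 0) (θ 1) x * G (x, θ)
          - G (x, θ) * Acomb (A 0) (A 1) (A 2) (θ 0) (θ 1) x) i j) 0) (s : ℝ) (x : R2) :
    G (x, unitDir s) = G (x, unitDir 0) := by
  obtain ⟨KA, hKA0, hKA⟩ := exists_entry_bound hAsm hAsupp
  obtain ⟨KB, hKB0, hKB⟩ := exists_entry_bound hBsm hBsupp
  have hKA' : ∀ k x i j, ‖A k x i j‖ ≤ KA + KB := fun k x i j => by linarith [hKA k x i j]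
  have hKB' : ∀ k x i j, ‖B k x i j‖ ≤ KA + KB := fun k x i j => by linarith [hKB k x i j]
  let F : Fin m × Fin m → ℝ × R2 → ℂ := fun l p => G (p.2, unitDir p.1) l.1 l.2
  have hF : ∀ l, SmoothPeriodic (F l) := fun l =>
    ⟨(hG l.1 l.2).comp (contDiff_snd.prodMk (contDiff_unitDir.comp contDiff_fst)),
      fun s x => by simp only [F, unitDir_add_one]⟩
  let P : ℂ → (Fin 3 → R2 → Mat m) → R2 → Mat m := fun c A x => (1 / 2 : ℂ) • (A 1 x + c • A 2 x)
  have hPK : ∀ c : ℂ, ‖c‖ = 1 → ∀ l l' x,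
      ‖sylvesterCoef (P c B x) (P c A x) l l'‖ ≤ (KA + KB) + (KA + KB) := fun c hc l l' x =>
    norm_sylvesterCoef_le (fun i j => norm_half_add_le (hKB' 1 x i j) (hKB' 2 x i j) hc)
      (fun i j => norm_half_add_le (hKA' 1 x i j) (hKA' 2 x i j) hc) l l'
  have hdX : ∀ l s x, dX (unitDir s) (F l) (s, x) = (Real.cos (2 * Real.pi * s) : ℂ) *
      dX e1 (F l) (s, x) + (Real.sin (2 * Real.pi * s) : ℂ) * dX e2 (F l) (s, x) := by
    intro l s x
    have h : ((0 : ℝ), unitDir s) = Real.cos (2 * Real.pi * s) • ((0 : ℝ), e1)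
        + Real.sin (2 * Real.pi * s) • ((0 : ℝ), e2) := by
      simp [unitDir]
    simp only [dX, h, map_add, map_smul, Complex.real_smul]
  have heqn : ∀ l s x, dX (unitDir s) (F l) (s, x)
      = (Acomb (B 0) (B 1) (B 2) (unitDir s 0) (unitDir s 1) x * G (x, unitDir s)
          - G (x, unitDir s) * Acomb (A 0) (A 1) (A 2) (unitDir s 0) (unitDir s 1) x) l.1 l.2 := by
    intro l s x
    have hd : DifferentiableAt ℝ (fun y => F l (s, y)) (x + (0 : ℝ) • unitDir s) :=
      ((hF l).smooth.comp (contDiff_const.prodMk contDiff_id)).differentiable (by simp) _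
    have h1 := hd.hasFDerivAt.comp_hasDerivAt (0 : ℝ)
      (((hasDerivAt_id (0 : ℝ)).smul_const (unitDir s)).const_add x)
    rw [zero_smul, add_zero, one_smul] at h1
    rw [dX_eq_pdv (hF l).smooth]
    exact h1.unique (hder (unitDir s) (norm_unitDir s) x l.1 l.2)
  ext i j
  refine transport_system_direction_independent hF hR (C := (KA + KB) + (KA + KB)) (by positivity)
    (fun l s x hx => ?_) (hPK (-Complex.I) (by simp)) (hPK Complex.I (by simp))
    (fun l l' x => norm_sylvesterCoef_le (hKB' 0 x) (hKA' 0 x) l l') (fun l s x => ?_) (i, j) s x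
  · refine (hasDerivAt_dS (hF l).smooth s x).unique ?_
    have h : (fun s => F l (s, x)) = fun _ => (1 : Mat m) l.1 l.2 := by
      funext s
      simp only [F, hout _ (norm_unitDir s) x hx]
    rw [h]
    exact hasDerivAt_const _ _
  · have h := heqn l s x
    rw [hdX, ← sum_sylvesterCoef] at h
    rw [expMode_one_eq, expMode_neg_one_eq]
    refine Eq.trans ?_ (h.trans (Finset.sum_congr rfl fun l' _ => ?_))
    · linear_combination (-(Real.sin (2 * Real.pi * s) : ℂ) * dX e2 (F l) (s, x)) * Complex.I_sq
    · congr 1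
      rw [unitDir_zero, unitDir_one]
      simp only [sylvesterCoef, Acomb, P, Matrix.add_apply, Matrix.smul_apply, smul_eq_mul]
      split_ifs
      · linear_combination ((Real.sin (2 * Real.pi * s) : ℂ) *
          (B 2 x l.1 l'.1 - A 2 x l'.2 l.2)) * Complex.I_sq
      · linear_combination ((Real.sin (2 * Real.pi * s) : ℂ) * B 2 x l.1 l'.1) * Complex.I_sq
      · linear_combination ((Real.sin (2 * Real.pi * s) : ℂ) * (- A 2 x l'.2 l.2)) * Complex.I_sq
      · ring

/-- Theorem 1.1: same non-abelian Radon transform implies gauge equivalence. -/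
theorem radon_gauge_equivalence (m : ℕ) (hm : 1 ≤ m) (R : ℝ) (hR : 0 < R)
    (A B : Fin 3 → R2 → Mat m)
    (hAsm : ∀ j, MatSmooth (A j)) (hBsm : ∀ j, MatSmooth (B j))
    (hAsupp : ∀ j, SuppIn (A j) R) (hBsupp : ∀ j, SuppIn (B j) R)
    -- S(A) = S(B): for every direction θ and every pair of solutions of the
    -- transport equations normalized to I_m at −∞ along lines, the limits at +∞ agree
    (hRadon : ∀ θ : R2, ‖θ‖ = 1 → ∀ cA cB : R2 → Mat m,
      Transport (Acomb (A 0) (A 1) (A 2) (θ 0) (θ 1)) θ cA →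
      Transport (Acomb (B 0) (B 1) (B 2) (θ 0) (θ 1)) θ cB →
      (∀ x : R2, Filter.Tendsto (fun s : ℝ => cA (x + s • θ)) Filter.atBot (nhds 1)) →
      (∀ x : R2, Filter.Tendsto (fun s : ℝ => cB (x + s • θ)) Filter.atBot (nhds 1)) →
      ∀ x : R2, ∀ LA LB : Mat m,
        Filter.Tendsto (fun s : ℝ => cA (x + s • θ)) Filter.atTop (nhds LA) →
        Filter.Tendsto (fun s : ℝ => cB (x + s • θ)) Filter.atTop (nhds LB) →
        LA = LB) :
    ∃ g : R2 → Mat m, MatSmooth g ∧ (∀ x, (g x).det ≠ 0) ∧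
      (∀ x : R2, R ≤ ‖x‖ → g x = 1) ∧
      (∀ x : R2, B 1 x = g x * A 1 x * (g x)⁻¹ +
        (Matrix.of fun i j => pdv e1 (fun y => g y i j) x) * (g x)⁻¹) ∧
      (∀ x : R2, B 2 x = g x * A 2 x * (g x)⁻¹ +
        (Matrix.of fun i j => pdv e2 (fun y => g y i j) x) * (g x)⁻¹) ∧
      (∀ x : R2, B 0 x = g x * A 0 x * (g x)⁻¹) := by
  obtain ⟨G, hG, hGθ⟩ := exists_gauge_family hAsm hBsm hAsupp hBsupp hRadon
  have hind := gauge_family_direction_independent hR hAsm hBsm hAsupp hBsupp hG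
    (fun θ hθ => (hGθ θ hθ).2.1) (fun θ hθ => (hGθ θ hθ).2.2)
  set g : R2 → Mat m := fun x => G (x, unitDir 0) with hg
  have hgs : MatSmooth g := fun i j => (hG i j).comp (contDiff_id.prodMk contDiff_const)
  have hdet : ∀ x, (g x).det ≠ 0 := (hGθ _ (norm_unitDir 0)).1
  let P : R2 → R2 → Mat m := fun v x => Matrix.of fun i j => pdv v (fun y => g y i j) x
  have hP : ∀ (s : ℝ) (x : R2), P (unitDir s) x
      = Acomb (B 0) (B 1) (B 2) (unitDir s 0) (unitDir s 1) x * g x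
        - g x * Acomb (A 0) (A 1) (A 2) (unitDir s 0) (unitDir s 1) x := by
    intro s x
    ext i j
    have hd : DifferentiableAt ℝ (fun y => g y i j) (x + (0 : ℝ) • unitDir s) :=
      (hgs i j).differentiable (by simp) _
    have h1 := hd.hasFDerivAt.comp_hasDerivAt (0 : ℝ)
      (((hasDerivAt_id (0 : ℝ)).smul_const (unitDir s)).const_add x)
    rw [zero_smul, add_zero, one_smul] at h1
    have h2 := (hGθ (unitDir s) (norm_unitDir s)).2.2 x i j
    simp only [hind s] at h2
    exact h1.unique h2
  have hd0 : unitDir 0 = e1 := by simp [unitDir]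
  have hd4 : unitDir (1 / 4) = e2 := by
    have h : 2 * Real.pi * (1 / 4) = Real.pi / 2 := by ring
    rw [unitDir, h]
    simp
  have hd2 : unitDir (1 / 2) = -e1 := by
    have h : 2 * Real.pi * (1 / 2) = Real.pi := by ring
    rw [unitDir, h]
    simp
  have hneg : ∀ x, P (-e1) x = -P e1 x := by
    intro x
    ext i j
    simp [P, pdv]
  have h0 := fun x => hP 0 x
  have h2 := fun x => hP (1 / 2) x
  have h4 := fun x => hP (1 / 4) x
  simp only [hd0, hd2, hd4, hneg, Acomb, PiLp.neg_apply, e1_zero, e1_one, e2_zero, e2_one,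
    Complex.ofReal_one, Complex.ofReal_zero, Complex.ofReal_neg, one_smul, zero_smul, neg_smul,
    zero_add, add_zero, neg_zero] at h0 h2 h4
  have hB0 : ∀ x, B 0 x * g x = g x * A 0 x := by
    intro x
    have h : (2 : ℂ) • (B 0 x * g x - g x * A 0 x) = 0 := by
      have h3 := congrArg₂ (· + ·) (h0 x) (h2 x)
      simp only [add_neg_cancel] at h3
      rw [h3, two_smul]
      noncomm_ring
    exact sub_eq_zero.1 ((smul_eq_zero.1 h).resolve_left two_ne_zero)
  have hinv : ∀ x, g x * (g x)⁻¹ = 1 := fun x =>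
    Matrix.mul_nonsing_inv _ (isUnit_iff_ne_zero.2 (hdet x))
  have hB1 : ∀ x, B 1 x * g x = g x * A 1 x + P e1 x := by
    intro x
    rw [h0 x, add_mul, mul_add, hB0 x]
    abel
  have hB2 : ∀ x, B 2 x * g x = g x * A 2 x + P e2 x := by
    intro x
    rw [h4 x, add_mul, mul_add, hB0 x]
    abel
  have hsolve : ∀ (x : R2) (X Y : Mat m), X * g x = Y → X = Y * (g x)⁻¹ := by
    intro x X Y h
    rw [← h, mul_assoc, hinv, mul_one]
  refine ⟨g, hgs, hdet, (hGθ _ (norm_unitDir 0)).2.1, fun x => ?_, fun x => ?_,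
    fun x => hsolve x _ _ (hB0 x)⟩
  · rw [← add_mul]
    exact hsolve x _ _ (hB1 x)
  · rw [← add_mul]
    exact hsolve x _ _ (hB2 x)
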